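/- arXiv:1803.04146 — 2 statements merged into one kernel-verified Lean document; each statement's English description precedes it below -/
import Mathlib

section
/- Let F be a homogeneous cubic form in the variables X₀, X₁, X₂, X₃ over ℂ that is smooth. Then the set of 2-dimensional ℂ-linear subspaces ℓ ⊆ ℂ⁴ such that F vanishes identically on ℓ has exactly 27 elements. (Cayley–Salmon: every smooth complex cubic surface contains exactly 27 lines.) -/
section PolynomialSystems

open MvPolynomial

/-- Fewer than `n` polynomials in `n` variables that vanish at the origin have another common
zero. -/
theorem exists_ne_zero_forall_eval_eq_zero {K : Type*} [Field K] [IsAlgClosed K] {n : ℕ}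
    (s : Finset (MvPolynomial (Fin n) K)) (hs : s.card < n) (h0 : ∀ f ∈ s, eval 0 f = 0) :
    ∃ x : Fin n → K, x ≠ 0 ∧ ∀ f ∈ s, eval x f = 0 := by
  classical
  by_contra! hcon
  have hfin : FiniteRingKrullDim (MvPolynomial (Fin n) K) := by
    rw [finiteRingKrullDim_iff_ne_bot_and_top]
    simpa using fun h ↦ ENat.natCast_ne_top n (WithBot.coe_injective h)
  obtain ⟨m, hm, hht⟩ := Ideal.exists_isMaximal_height (R := MvPolynomial (Fin n) K)
  obtain ⟨a, rfl⟩ := isMaximal_iff_eq_vanishingIdeal_singleton.1 hm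
  have hdim : (vanishingIdeal K {a} : Ideal (MvPolynomial (Fin n) K)).height = n := by
    have : ((vanishingIdeal K {a} : Ideal (MvPolynomial (Fin n) K)).height : WithBot ℕ∞)
        = ((n : ℕ∞) : WithBot ℕ∞) := by
      rw [hht]; simp
    exact_mod_cast this
  let τ : MvPolynomial (Fin n) K →ₐ[K] MvPolynomial (Fin n) K := aeval fun i ↦ X i - C (a i)
  have hτ (x : Fin n → K) (f : MvPolynomial (Fin n) K) : aeval x (τ f) = eval (x - a) f := by
    induction f using MvPolynomial.induction_on with
    | C c => simp [τ]
    | add p q hp hq => simp only [map_add, hp, hq]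
    | mul_X p i hp => simp only [map_mul, hp]; simp [τ]
  have hzero : zeroLocus K (Ideal.span (s.image τ : Set (MvPolynomial (Fin n) K))) = {a} := by
    rw [zeroLocus_span]
    ext x
    simp only [Finset.coe_image, Set.forall_mem_image, SetLike.mem_coe, Set.mem_ofPred_eq,
      hτ, Set.mem_singleton_iff]
    refine ⟨fun h ↦ ?_, ?_⟩
    · by_contra hx
      obtain ⟨f, hf, hne⟩ := hcon (x - a) (sub_ne_zero.2 hx)
      exact hne (h hf)
    · rintro rfl f hf
      rw [sub_self]
      exact h0 f hf
  have hmin : (vanishingIdeal K {a} : Ideal (MvPolynomial (Fin n) K)) ∈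
      (Ideal.span (s.image τ : Set (MvPolynomial (Fin n) K))).minimalPrimes := by
    rw [← Ideal.radical_minimalPrimes, ← vanishingIdeal_zeroLocus_eq_radical (K := K), hzero,
      Ideal.minimalPrimes_eq_subsingleton_self]
    rfl
  have := Ideal.height_le_card_of_mem_minimalPrimes_span_finset hmin
  rw [hdim] at this
  have h2 : n ≤ (s.image τ).card := by exact_mod_cast this
  exact absurd (h2.trans Finset.card_image_le) (not_le.2 hs)

theorem exists_binary_quadratic_eq_zero {K : Type*} [Field K] [IsAlgClosed K] (a b c : K) :
    ∃ x y : K, (x ≠ 0 ∨ y ≠ 0) ∧ a * x ^ 2 + b * x * y + c * y ^ 2 = 0 := by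
  obtain ⟨x, hx, h⟩ := exists_ne_zero_forall_eval_eq_zero (n := 2)
    {C a * X 0 ^ 2 + C b * X 0 * X 1 + C c * X 1 ^ 2} (by simp) (by simp)
  refine ⟨x 0, x 1, ?_, by simpa using h⟩
  by_contra! h0
  exact hx (by ext i; fin_cases i <;> simp [h0])

theorem exists_binary_cubic_eq_zero {K : Type*} [Field K] [IsAlgClosed K] (a b c d : K) :
    ∃ x y : K, (x ≠ 0 ∨ y ≠ 0) ∧ a * x ^ 3 + b * x ^ 2 * y + c * x * y ^ 2 + d * y ^ 3 = 0 := by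
  obtain ⟨x, hx, h⟩ := exists_ne_zero_forall_eval_eq_zero (n := 2)
    {C a * X 0 ^ 3 + C b * X 0 ^ 2 * X 1 + C c * X 0 * X 1 ^ 2 + C d * X 1 ^ 3}
    (by simp) (by simp)
  refine ⟨x 0, x 1, ?_, by simpa using h⟩
  by_contra! h0
  exact hx (by ext i; fin_cases i <;> simp [h0])

/-- The equations for a line on the surface
`a x² z + c y³ + b z² t = 0` (with an `E₆` singularity) through two points
`(1, α, γ, 0)` and `(0, y, z, 1)` have only the trivial solution. -/
theorem eq_zero_of_cuspidal_equations {K : Type*} [Field K] [CharZero K] {a b c α γ y z : K}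
    (ha : a ≠ 0) (hb : b ≠ 0) (hc : c ≠ 0)
    (h₁ : 3 * γ * a + α ^ 3 * c = 0) (h₂ : y * α ^ 2 * c + z * a + γ ^ 2 * b = 0)
    (h₃ : y ^ 2 * α * c + 2 * z * γ * b = 0) (h₄ : y ^ 3 * c + 3 * z ^ 2 * b = 0) :
    α = 0 ∧ γ = 0 ∧ y = 0 ∧ z = 0 := by
  have hα : α = 0 := by
    by_contra hα
    obtain ⟨c, rfl⟩ : ∃ e, c = a * e := ⟨c / a, by field_simp⟩
    obtain ⟨b, rfl⟩ : ∃ e, b = a * e := ⟨b / a, by field_simp⟩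
    obtain ⟨y, rfl⟩ : ∃ e, y = α ^ 4 * c * b * e :=
      ⟨y / (α ^ 4 * c * b), by field_simp [right_ne_zero_of_mul hb, right_ne_zero_of_mul hc]⟩
    have hb' := right_ne_zero_of_mul hb
    have hc' := right_ne_zero_of_mul hc
    have hγ : γ = -(α ^ 3 * c) / 3 := by
      apply mul_left_cancel₀ ha
      linear_combination h₁ / 3
    subst hγ
    have hz : z = 3 / 2 * α ^ 6 * c ^ 2 * b * y ^ 2 := by
      apply mul_left_cancel₀ (mul_ne_zero (mul_ne_zero (mul_ne_zero ha hb') hc') (pow_ne_zero 3 hα))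
      linear_combination -3 / 2 * h₃
    subst hz
    have h5 : y + 3 / 2 * y ^ 2 + 1 / 9 = 0 := by
      apply mul_left_cancel₀ (mul_ne_zero (mul_ne_zero (mul_ne_zero ha hb') (pow_ne_zero 2 hc'))
        (pow_ne_zero 6 hα))
      linear_combination h₂
    have h6 : y ^ 3 * (1 + 27 / 4 * y) = 0 := by
      apply mul_left_cancel₀ (mul_ne_zero (mul_ne_zero (mul_ne_zero ha (pow_ne_zero 3 hb'))
        (pow_ne_zero 4 hc')) (pow_ne_zero 12 hα))
      linear_combination h₄
    rcases mul_eq_zero.1 h6 with h | h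
    · rw [pow_eq_zero_iff three_ne_zero] at h
      subst h
      norm_num at h5
    · have : y = -4 / 27 := by linear_combination 4 / 27 * h
      subst this
      norm_num at h5
  subst hα
  have hγ : γ = 0 := by simpa [ha] using h₁
  subst hγ
  have hz : z = 0 := by simpa [ha] using h₂
  subst hz
  simpa [hc] using h₄

/-- A solution of the equations for a line in the degeneration `β → 0` of a cubic surface with a
cuspidal tangent plane section to the surface of `eq_zero_of_cuspidal_equations`. -/
theorem exists_cuspidal_equations_solution {K : Type*} [Field K] [IsAlgClosed K] [CharZero K]
    {a b c : K} (ha : a ≠ 0) (hb : b ≠ 0) (hc : c ≠ 0)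
    (d₁ d₂ d₃ h₁ h₂ h₃ h₄ h₅ h₆ h₇ h₈ : K) :
    ∃ α γ β y z : K, β ≠ 0 ∧
      3 * γ * a + α ^ 3 * c + 3 * β * α ^ 2 * d₁ + 3 * β ^ 2 * α * d₂ + β ^ 3 * d₃ = 0 ∧
      y * (α ^ 2 * c + 2 * β * α * d₁ + β ^ 2 * d₂) + z * a +
        (β ^ 6 * h₁ + 2 * β ^ 5 * α * h₂ + β ^ 4 * α ^ 2 * h₃ + 2 * β ^ 3 * γ * h₇ + γ ^ 2 * b)
        = 0 ∧
      y ^ 2 * (β * d₁ + α * c) + 2 * β ^ 2 * y * (β ^ 3 * h₂ + β ^ 2 * α * h₃) +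
        2 * z * (β ^ 3 * h₇ + γ * b) + β ^ 6 * (β ^ 3 * h₄ + β ^ 2 * α * h₅ + γ * h₈) = 0 ∧
      y ^ 3 * c + 3 * z ^ 2 * b + 3 * β ^ 4 * y ^ 2 * h₃ + 3 * β ^ 8 * y * h₅ +
        3 * z * β ^ 6 * h₈ + β ^ 12 * h₆ = 0 := by
  classical
  let α : MvPolynomial (Fin 5) K := X 0
  let γ : MvPolynomial (Fin 5) K := X 1
  let β : MvPolynomial (Fin 5) K := X 2
  let y : MvPolynomial (Fin 5) K := X 3
  let z : MvPolynomial (Fin 5) K := X 4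
  obtain ⟨x, hx, h⟩ := exists_ne_zero_forall_eval_eq_zero (n := 5)
    {3 * γ * C a + α ^ 3 * C c + 3 * β * α ^ 2 * C d₁ + 3 * β ^ 2 * α * C d₂ + β ^ 3 * C d₃,
      y * (α ^ 2 * C c + 2 * β * α * C d₁ + β ^ 2 * C d₂) + z * C a +
        (β ^ 6 * C h₁ + 2 * β ^ 5 * α * C h₂ + β ^ 4 * α ^ 2 * C h₃ + 2 * β ^ 3 * γ * C h₇ +
          γ ^ 2 * C b),
      y ^ 2 * (β * C d₁ + α * C c) + 2 * β ^ 2 * y * (β ^ 3 * C h₂ + β ^ 2 * α * C h₃) +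
        2 * z * (β ^ 3 * C h₇ + γ * C b) +
        β ^ 6 * (β ^ 3 * C h₄ + β ^ 2 * α * C h₅ + γ * C h₈),
      y ^ 3 * C c + 3 * z ^ 2 * C b + 3 * β ^ 4 * y ^ 2 * C h₃ + 3 * β ^ 8 * y * C h₅ +
        3 * z * β ^ 6 * C h₈ + β ^ 12 * C h₆}
    (Nat.lt_succ_of_le Finset.card_le_four) (by simp [α, β, γ, y, z])
  simp only [Finset.forall_mem_insert, Finset.mem_singleton, forall_eq] at h
  simp [α, β, γ, y, z] at h
  refine ⟨x 0, x 1, x 2, x 3, x 4, fun hβ ↦ hx ?_, h⟩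
  simp only [hβ] at h
  obtain ⟨e₁, e₂, e₃, e₄⟩ := eq_zero_of_cuspidal_equations ha hb hc
    (α := x 0) (γ := x 1) (y := x 3) (z := x 4) (by linear_combination h.1)
    (by linear_combination h.2.1) (by linear_combination h.2.2.1) (by linear_combination h.2.2.2)
  ext i
  fin_cases i <;> simp [*]

end PolynomialSystems

section CubicSurfaces

open Module

/-- The polar form of a smooth cubic form on `V`: a symmetric trilinear form for which no nonzero
vector `v` annihilates `V` through `form v v`. -/
structure SmoothCubic (K V : Type*) [Field K] [AddCommGroup V] [Module K V] where
  form : V →ₗ[K] V →ₗ[K] V →ₗ[K] K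
  swap_left : ∀ u v w, form u v w = form v u w
  swap_right : ∀ u v w, form u v w = form u w v
  smooth : ∀ v, v ≠ 0 → ∃ w, form v v w ≠ 0

namespace SmoothCubic

variable {K V : Type*} [Field K] [AddCommGroup V] [Module K V]

/-- The lines of the projective cubic surface defined by `S`. -/
def lines (S : SmoothCubic K V) : Set (Submodule K V) :=
  {ℓ | finrank K ℓ = 2 ∧ ∀ v ∈ ℓ, S.form v v v = 0}

theorem form_eq_zero_of_mem [CharZero K] (S : SmoothCubic K V) {W : Submodule K V}
    (hW : ∀ v ∈ W, S.form v v v = 0) {u v w : V} (hu : u ∈ W) (hv : v ∈ W) (hw : w ∈ W) :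
    S.form u v w = 0 := by
  have h₁ := hW _ (add_mem (add_mem hu hv) hw)
  have h₂ := hW _ (add_mem hu hv)
  have h₃ := hW _ (add_mem hu hw)
  have h₄ := hW _ (add_mem hv hw)
  have h₅ := hW _ hu
  have h₆ := hW _ hv
  have h₇ := hW _ hw
  simp only [map_add, LinearMap.add_apply, S.swap_left, S.swap_right] at *
  have : (6 : K) * S.form u v w = 0 := by
    linear_combination h₁ - h₂ - h₃ - h₄ + h₅ + h₆ + h₇
  simpa using this

theorem span_pair_mem_lines (S : SmoothCubic K V) {u v : V} (h : LinearIndependent K ![u, v])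
    (h₁ : S.form u u u = 0) (h₂ : S.form u u v = 0) (h₃ : S.form u v v = 0)
    (h₄ : S.form v v v = 0) : Submodule.span K {u, v} ∈ S.lines := by
  refine ⟨?_, fun w hw ↦ ?_⟩
  · rw [← Matrix.range_cons_cons_empty, finrank_span_eq_card h, Fintype.card_fin]
  · obtain ⟨a, b, rfl⟩ := Submodule.mem_span_pair.1 hw
    simp only [map_add, map_smul, LinearMap.add_apply, LinearMap.smul_apply, smul_eq_mul,
      S.swap_left v u, S.swap_right v v u, S.swap_right u v u, h₁, h₂, h₃, h₄]
    ring

open MvPolynomial in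
/-- A cubic surface has a parabolic point: its Hessian form is degenerate there. -/
theorem exists_parabolic [IsAlgClosed K] (hV : finrank K V = 4) (S : SmoothCubic K V) :
    ∃ p ≠ 0, S.form p p p = 0 ∧ ∃ w ≠ 0, ∀ u, S.form p w u = 0 := by
  classical
  have : FiniteDimensional K V := .of_finrank_eq_succ hV
  let b := finBasisOfFinrankEq K V hV
  let M : Matrix (Fin 4) (Fin 4) (MvPolynomial (Fin 4) K) :=
    .of fun i j ↦ ∑ k, C (S.form (b k) (b i) (b j)) * X k
  let f : MvPolynomial (Fin 4) K := ∑ i, ∑ j, M i j * X i * X j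
  have hM (x : Fin 4 → K) (i j) : eval x (M i j) = S.form (∑ k, x k • b k) (b i) (b j) := by
    simp [M, mul_comm]
  have hf (x : Fin 4 → K) :
      eval x f = S.form (∑ k, x k • b k) (∑ k, x k • b k) (∑ k, x k • b k) := by
    simp only [f, map_sum, map_mul, hM, eval_X]
    simp only [map_smul, LinearMap.sum_apply, LinearMap.smul_apply, smul_eq_mul,
      Finset.mul_sum]
    rw [Finset.sum_comm]
    simp only [Finset.sum_mul]
    refine Finset.sum_congr rfl fun i _ ↦ Finset.sum_congr rfl fun j _ ↦
      Finset.sum_congr rfl fun k _ ↦ by ring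
  have hdet (x : Fin 4 → K) : eval x M.det = ((eval x).mapMatrix M).det := RingHom.map_det _ _
  obtain ⟨x, hx, h⟩ := exists_ne_zero_forall_eval_eq_zero (n := 4) {f, M.det}
    (Finset.card_le_two.trans_lt (by norm_num)) (by
      simp only [Finset.forall_mem_insert, Finset.mem_singleton, forall_eq]
      refine ⟨by rw [hf]; simp, ?_⟩
      rw [hdet]
      convert! Matrix.det_zero (n := Fin 4) (R := K)
      ext i j
      simp [M])
  simp only [Finset.forall_mem_insert, Finset.mem_singleton, forall_eq] at h
  have hne (y : Fin 4 → K) (hy : y ≠ 0) : ∑ k, y k • b k ≠ 0 := fun h0 ↦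
    hy (funext (Fintype.linearIndependent_iff.1 b.linearIndependent y h0))
  refine ⟨∑ k, x k • b k, hne x hx, by rw [← hf, h.1], ?_⟩
  rw [hdet] at h
  obtain ⟨y, hy, hy0⟩ := Matrix.exists_vecMul_eq_zero_iff.2 h.2
  refine ⟨∑ k, y k • b k, hne y hy, fun u ↦ ?_⟩
  have : S.form (∑ k, x k • b k) (∑ k, y k • b k) = 0 := by
    refine b.ext fun j ↦ ?_
    have := congrFun hy0 j
    simp only [Matrix.vecMul, dotProduct, RingHom.mapMatrix_apply, Matrix.map_apply, hM,
      Pi.zero_apply] at this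
    rw [map_sum]
    simpa using this
  rw [this, LinearMap.zero_apply]

/-- **Existence of a line** on a smooth cubic surface. -/
theorem lines_nonempty [IsAlgClosed K] [CharZero K] (hV : finrank K V = 4)
    (S : SmoothCubic K V) : S.lines.Nonempty := by
  have : FiniteDimensional K V := .of_finrank_eq_succ hV
  classical
  obtain ⟨p, hp, hppp, w, hw, hpw⟩ := S.exists_parabolic hV
  obtain ⟨v, hv⟩ := S.smooth p hp
  have hwp (c : K) : w ≠ c • p := by
    rintro rfl
    have := hpw v
    simp [hv] at this
    exact hw (by simp [this])
  obtain ⟨u, hu, hu'⟩ : ∃ u ∈ LinearMap.ker (S.form p p), u ∉ Submodule.span K {p, w} := by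
    by_contra! h
    have h₁ := Submodule.finrank_mono (show _ ≤ _ from h)
    have h₂ := (finrank_span_finset_le_card (R := K) {p, w}).trans Finset.card_le_two
    rw [Finset.coe_pair, Set.finrank] at h₂
    have h₃ := (S.form p p).finrank_range_add_finrank_ker
    have h₄ := (LinearMap.range (S.form p p)).finrank_le
    rw [finrank_self] at h₄
    omega
  rw [LinearMap.mem_ker] at hu
  rw [Submodule.mem_span_pair] at hu'
  push Not at hu'
  have hind {x y : K} (hxy : x ≠ 0 ∨ y ≠ 0) : LinearIndependent K ![p, x • u + y • w] := by
    rw [LinearIndependent.pair_iff' hp]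
    intro c h
    by_cases hx : x = 0
    · subst hx
      simp at hxy
      exact hwp (y⁻¹ * c) (by rw [mul_smul, h]; simp [hxy])
    · refine hu' (x⁻¹ * c) (- x⁻¹ * y) ?_
      rw [mul_smul, h]
      simp [hx, mul_smul]
  have hppw : S.form p p w = 0 := by rw [S.swap_right, hpw]
  have hpxw (x) : S.form p x w = 0 := by rw [S.swap_right, hpw]
  by_cases ha : S.form p u u = 0
  · obtain ⟨x, y, hxy, h⟩ := exists_binary_cubic_eq_zero (S.form u u u) (3 * S.form w u u)
      (3 * S.form w w u) (S.form w w w)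
    refine ⟨_, S.span_pair_mem_lines (hind hxy) hppp ?_ ?_ ?_⟩
    · simp [hu, hppw]
    · simp [hpxw, hpw, ha]
    · simp only [map_add, map_smul, LinearMap.add_apply, LinearMap.smul_apply, smul_eq_mul]
      simp only [S.swap_left, S.swap_right] at h ⊢
      linear_combination h
  by_cases hc : S.form w w w = 0
  · refine ⟨_, S.span_pair_mem_lines (hind (x := 0) (y := 1) (by simp)) hppp ?_ ?_ ?_⟩ <;>
    simp [hpw, hppw, hc]
  obtain ⟨α, γ, β, y, z, hβ, e₁, e₂, e₃, e₄⟩ := exists_cuspidal_equations_solution ha hv hc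
    (S.form w w u) (S.form w u u) (S.form u u u) (S.form u u v) (S.form u w v) (S.form w w v)
    (S.form u v v) (S.form w v v) (S.form v v v) (S.form p u v) (S.form p v v)
  have hwpp : S.form w p p = 0 := by rw [S.swap_left, hpw]
  have hpup : S.form p u p = 0 := by rw [S.swap_right, hu]
  have hupp : S.form u p p = 0 := by rw [S.swap_left, hpup]
  have hwpx (x) : S.form w p x = 0 := by rw [S.swap_left, hpw]
  have hwxp (x) : S.form w x p = 0 := by rw [S.swap_right, hwpx]
  have hxwp (x) : S.form x w p = 0 := by rw [S.swap_left, hwxp]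
  have hxpw (x) : S.form x p w = 0 := by rw [S.swap_right, hxwp]
  refine ⟨_, S.span_pair_mem_lines (u := β ^ 3 • u + (β ^ 2 * α) • w + γ • p)
    (v := (β ^ 2 * y) • w + z • p + β ^ 6 • v) ?_ ?_ ?_ ?_ ?_⟩
  · rw [LinearIndependent.pair_iff]
    intro s t h
    have ht : t = 0 := by
      have := congrArg (S.form p p) h
      simpa [hu, hppw, hppp, hβ, hv] using this
    subst ht
    refine ⟨?_, rfl⟩
    by_contra hs
    have h : (s * β ^ 3) • u = -(s * (β ^ 2 * α)) • w - (s * γ) • p := by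
      rw [zero_smul, add_zero] at h
      linear_combination (norm := module) h
    have h0 : s * β ^ 3 ≠ 0 := mul_ne_zero hs (pow_ne_zero 3 hβ)
    refine hu' (-((s * β ^ 3)⁻¹ * (s * γ))) (-((s * β ^ 3)⁻¹ * (s * (β ^ 2 * α)))) ?_
    apply smul_right_injective V h0
    simp only [smul_add, h, smul_smul, mul_neg, mul_inv_cancel_left₀ h0]
    module
  all_goals
    simp only [map_add, map_smul, LinearMap.add_apply, LinearMap.smul_apply, smul_eq_mul, hpw,
      hpxw, hwpx, hwxp, hxwp, hxpw, hppp, hu, hupp, hpup]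
    simp only [S.swap_left, S.swap_right] at e₁ e₂ e₃ e₄ ⊢
  · linear_combination β ^ 6 * e₁
  · linear_combination β ^ 6 * e₂
  · linear_combination β ^ 6 * e₃
  · linear_combination β ^ 6 * e₄

/-- The tangent planes of a smooth cubic surface at the points of a line do not all coincide. -/
theorem exists_form_ne_zero [IsAlgClosed K] (hV : finrank K V = 4) (S : SmoothCubic K V)
    {P W : Submodule K V} (hP : finrank K P = 3) (hW : 2 ≤ finrank K W) :
    ∃ v ∈ W, ∃ u ∈ P, S.form v v u ≠ 0 := by
  have : FiniteDimensional K V := .of_finrank_eq_succ hV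
  by_contra! hcon
  obtain ⟨e, he⟩ : ∃ e, e ∉ P := by
    by_contra! h
    rw [(Submodule.eq_top_iff' (p := P)).2 h, finrank_top] at hP
    omega
  have htop : P ⊔ Submodule.span K {e} = ⊤ := by
    apply Submodule.eq_top_of_finrank_eq
    have := Submodule.finrank_lt_finrank_of_lt (show P < P ⊔ Submodule.span K {e} from
      left_lt_sup.2 fun h ↦ he (h (Submodule.mem_span_singleton_self e)))
    have := (P ⊔ Submodule.span K {e}).finrank_le
    omega
  obtain ⟨f, hf⟩ := exists_linearIndependent_of_le_finrank hW
  obtain ⟨x, y, hxy, h⟩ := exists_binary_quadratic_eq_zero (S.form (f 0) (f 0) e)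
    (2 * S.form (f 0) (f 1) e) (S.form (f 1) (f 1) e)
  have hv0 : (x • f 0 + y • f 1 : V) ≠ 0 := by
    intro h0
    have := LinearIndependent.pair_iff.1
      (show LinearIndependent K ![f 0, f 1] by convert hf; ext i; fin_cases i <;> rfl) x y
      (Subtype.ext h0)
    tauto
  obtain ⟨w, hw⟩ := S.smooth _ hv0
  obtain ⟨u, hu, c, hc, rfl⟩ := Submodule.mem_sup.1 (htop.symm ▸ Submodule.mem_top : w ∈ _)
  obtain ⟨c, rfl⟩ := Submodule.mem_span_singleton.1 hc
  apply hw
  rw [map_add, hcon _ (add_mem (W.smul_mem x (f 0).2) (W.smul_mem y (f 1).2)) u hu]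
  simp only [map_add, map_smul, LinearMap.add_apply, LinearMap.smul_apply, smul_eq_mul,
    S.swap_left (f 1) (f 0)]
  linear_combination c * h

theorem _root_.Submodule.finrank_le_finrank_inf_ker_add_one [FiniteDimensional K V]
    (W : Submodule K V) (f : Dual K V) :
    finrank K W ≤ finrank K (W ⊓ LinearMap.ker f : Submodule K V) + 1 := by
  have h₁ := (f.domRestrict W).finrank_range_add_finrank_ker
  have h₂ := (LinearMap.range (f.domRestrict W)).finrank_le
  rw [finrank_self] at h₂
  have h₃ : finrank K (W ⊓ LinearMap.ker f : Submodule K V) =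
      finrank K (LinearMap.ker (f.domRestrict W)) := by
    rw [LinearMap.ker_domRestrict, ← Submodule.map_comap_subtype,
      ← (Submodule.equivMapOfInjective _ W.injective_subtype _).finrank_eq]
  omega

/-- The plane `P` is tritangent: it cuts the surface in the lines where one of the linear forms
`l i` vanishes. -/
structure IsTritangent (S : SmoothCubic K V) (P : Submodule K V) (l : Fin 3 → Dual K V) :
    Prop where
  finrank_eq : finrank K P = 3
  form_eq : ∀ v ∈ P, S.form v v v = l 0 v * l 1 v * l 2 v

namespace IsTritangent

variable {S : SmoothCubic K V} {P : Submodule K V} {l : Fin 3 → Dual K V}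

theorem form_eq_zero [CharZero K] (h : S.IsTritangent P l) {i j : Fin 3} (hij : i ≠ j) {u v : V}
    (hv : v ∈ P) (hu : u ∈ P) (hi : l i v = 0) (hj : l j v = 0) : S.form v v u = 0 := by
  have h₁ := h.form_eq _ (add_mem hv hu)
  have h₂ := h.form_eq _ (sub_mem hv hu)
  have h₃ := h.form_eq _ hu
  simp only [map_add, map_sub, LinearMap.add_apply, LinearMap.sub_apply, S.swap_left u v,
    S.swap_right v u v] at h₁ h₂
  have h₄ : 3 * S.form v v u =
      l 0 u * l 1 v * l 2 v + l 0 v * l 1 u * l 2 v + l 0 v * l 1 v * l 2 u := by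
    linear_combination (h₁ - h₂) / 2 - h₃
  have h₅ : 3 * S.form v v u = 0 := by
    rw [h₄]
    fin_cases i <;> fin_cases j <;> simp_all
  simpa using h₅

/-- A line not contained in a tritangent plane meets exactly one of the lines in that plane. -/
theorem existsUnique_inf_ne_bot [CharZero K] (hV : finrank K V = 4) (h : S.IsTritangent P l)
    {m : Submodule K V} (hm : m ∈ S.lines) (hmP : ¬ m ≤ P) :
    ∃! i, m ⊓ (P ⊓ LinearMap.ker (l i)) ≠ ⊥ := by
  have : FiniteDimensional K V := .of_finrank_eq_succ hV
  have hlt := Submodule.finrank_lt_finrank_of_lt (inf_lt_left.2 hmP)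
  have hsup := Submodule.finrank_sup_add_finrank_inf_eq m P
  have hlt' := Submodule.finrank_lt_finrank_of_lt (right_lt_sup.2 hmP)
  have hle := (m ⊔ P).finrank_le
  rw [hm.1] at hlt hsup
  rw [h.finrank_eq] at hsup hlt'
  have hone : finrank K (m ⊓ P : Submodule K V) = 1 := by omega
  have htop : m ⊔ P = ⊤ := Submodule.eq_top_of_finrank_eq (by omega)
  obtain ⟨⟨v, hvm, hvP⟩, hv0, hv⟩ := finrank_eq_one_iff'.1 hone
  replace hv0 : v ≠ 0 := fun h ↦ hv0 (Subtype.ext h)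
  have hmeet (i) : m ⊓ (P ⊓ LinearMap.ker (l i)) ≠ ⊥ ↔ l i v = 0 := by
    rw [Submodule.ne_bot_iff]
    refine ⟨?_, fun hi ↦ ⟨v, ⟨hvm, hvP, hi⟩, hv0⟩⟩
    rintro ⟨w, ⟨hwm, hwP, hi⟩, hw0⟩
    obtain ⟨c, hc⟩ := hv ⟨w, hwm, hwP⟩
    obtain rfl : c • v = w := congrArg Subtype.val hc
    have hc0 : c ≠ 0 := by
      rintro rfl
      simp at hw0
    simpa [hc0] using hi
  simp only [hmeet]
  refine existsUnique_of_exists_of_unique ?_ fun i j hi hj ↦ ?_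
  · have := h.form_eq v hvP
    rw [hm.2 v hvm] at this
    simpa [Fin.exists_fin_succ, or_assoc] using this.symm
  · by_contra hij
    obtain ⟨w, hw⟩ := S.smooth v hv0
    obtain ⟨a, ha, u, hu, rfl⟩ := Submodule.mem_sup.1 (htop.symm ▸ Submodule.mem_top : w ∈ _)
    apply hw
    rw [map_add, h.form_eq_zero hij hvP hu hi hj, S.form_eq_zero_of_mem hm.2 hvm hvm ha, add_zero]

variable [IsAlgClosed K] [CharZero K]

theorem finrank_inf_le_one (hV : finrank K V = 4) (h : S.IsTritangent P l) {i j : Fin 3}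
    (hij : i ≠ j) :
    finrank K (P ⊓ LinearMap.ker (l i) ⊓ LinearMap.ker (l j) : Submodule K V) ≤ 1 := by
  by_contra! hlt
  obtain ⟨v, ⟨⟨hv, hi⟩, hj⟩, u, hu, hne⟩ := S.exists_form_ne_zero hV h.finrank_eq hlt
  exact hne (h.form_eq_zero hij hv hu hi hj)

theorem finrank_side (hV : finrank K V = 4) (h : S.IsTritangent P l) (i : Fin 3) :
    finrank K (P ⊓ LinearMap.ker (l i) : Submodule K V) = 2 := by
  have : FiniteDimensional K V := .of_finrank_eq_succ hV
  obtain ⟨j, hij⟩ := exists_ne i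
  have h₁ := P.finrank_le_finrank_inf_ker_add_one (l i)
  have h₂ := (P ⊓ LinearMap.ker (l i)).finrank_le_finrank_inf_ker_add_one (l j)
  have h₃ := h.finrank_inf_le_one hV hij.symm
  rw [h.finrank_eq] at h₁
  omega

theorem side_mem_lines (hV : finrank K V = 4) (h : S.IsTritangent P l) (i : Fin 3) :
    P ⊓ LinearMap.ker (l i) ∈ S.lines := by
  refine ⟨h.finrank_side hV i, fun v ⟨hv, hi⟩ ↦ ?_⟩
  rw [SetLike.mem_coe, LinearMap.mem_ker] at hi
  rw [h.form_eq v hv]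
  fin_cases i <;> simp_all

theorem side_injective (hV : finrank K V = 4) (h : S.IsTritangent P l) :
    Function.Injective fun i ↦ P ⊓ LinearMap.ker (l i) := by
  intro i j hij
  by_contra hne
  have h₁ := h.finrank_inf_le_one hV hne
  have h₂ : P ⊓ LinearMap.ker (l i) ⊓ LinearMap.ker (l j) = P ⊓ LinearMap.ker (l i) := by
    dsimp only at hij
    rw [inf_eq_left, hij]
    exact inf_le_right
  rw [h₂, h.finrank_side hV] at h₁
  omega

theorem eq_of_ker_le_ker (hV : finrank K V = 4) (h : S.IsTritangent P l) {i j : Fin 3}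
    (hij : LinearMap.ker (l i) ≤ LinearMap.ker (l j)) : i = j := by
  have : FiniteDimensional K V := .of_finrank_eq_succ hV
  exact h.side_injective hV (Submodule.eq_of_le_of_finrank_eq (inf_le_inf_left P hij)
    (by rw [h.finrank_side hV, h.finrank_side hV]))

theorem eq_side_of_le (hV : finrank K V = 4) (h : S.IsTritangent P l) {m : Submodule K V}
    (hm : m ∈ S.lines) (hmP : m ≤ P) : ∃ i, m = P ⊓ LinearMap.ker (l i) := by
  have : FiniteDimensional K V := .of_finrank_eq_succ hV
  obtain ⟨i, hi⟩ : ∃ i, ∀ v ∈ m, l i v = 0 := by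
    by_contra! hcon
    obtain ⟨v, hv, hne⟩ := Module.Dual.exists_forall_mem_ne_zero_of_forall_exists m l hcon
    have := hm.2 v hv
    rw [h.form_eq v (hmP hv)] at this
    simp [hne] at this
  exact ⟨i, Submodule.eq_of_le_of_finrank_eq (le_inf hmP hi)
    (by rw [hm.1, h.finrank_side hV])⟩

theorem side_inf_side_ne_bot (hV : finrank K V = 4) (h : S.IsTritangent P l) (i j : Fin 3) :
    P ⊓ LinearMap.ker (l i) ⊓ (P ⊓ LinearMap.ker (l j)) ≠ ⊥ := by
  have : FiniteDimensional K V := .of_finrank_eq_succ hV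
  intro h0
  have h₁ := (P ⊓ LinearMap.ker (l i)).finrank_le_finrank_inf_ker_add_one (l j)
  have h₂ : P ⊓ LinearMap.ker (l i) ⊓ LinearMap.ker (l j) ≤ ⊥ := by
    rw [← h0]
    exact le_inf inf_le_left (inf_le_inf_right _ inf_le_left)
  rw [h.finrank_side hV, le_bot_iff.1 h₂, finrank_bot] at h₁
  omega

end IsTritangent

theorem exists_ternary_quadratic_eq_mul_of_ne_zero [IsAlgClosed K] {a b c d e g : K}
    (ha : a ≠ 0) (h : a * c * g + 2 * b * d * e - a * e ^ 2 - b ^ 2 * g - c * d ^ 2 = 0) :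
    ∃ x y : Fin 3 → K, a = x 0 * y 0 ∧ 2 * b = x 0 * y 1 + x 1 * y 0 ∧ c = x 1 * y 1 ∧
      2 * d = x 0 * y 2 + x 2 * y 0 ∧ 2 * e = x 1 * y 2 + x 2 * y 1 ∧ g = x 2 * y 2 := by
  obtain ⟨α, hα⟩ := IsAlgClosed.exists_pow_nat_eq (b ^ 2 - a * c) two_pos
  obtain ⟨β, hβ, hαβ⟩ : ∃ β, β ^ 2 = d ^ 2 - a * g ∧ α * β = b * d - a * e := by
    obtain ⟨β, hβ⟩ := IsAlgClosed.exists_pow_nat_eq (d ^ 2 - a * g) two_pos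
    have : (α * β) ^ 2 = (b * d - a * e) ^ 2 := by
      rw [mul_pow, hα, hβ]
      linear_combination a * h
    rcases sq_eq_sq_iff_eq_or_eq_neg.1 this with h | h
    · exact ⟨β, hβ, h⟩
    · exact ⟨-β, by rw [neg_sq, hβ], by linear_combination -h⟩
  refine ⟨![1, (b + α) / a, (d + β) / a], ![a, b - α, d - β], ?_, ?_, ?_, ?_, ?_, ?_⟩ <;>
    simp <;> field_simp
  · ring
  · linear_combination hα
  · ring
  · linear_combination 2 * hαβ
  · linear_combination hβ

/-- A singular conic is a union of two lines. -/
theorem exists_ternary_quadratic_eq_mul [IsAlgClosed K] [CharZero K] {a b c d e g : K}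
    (h : a * c * g + 2 * b * d * e - a * e ^ 2 - b ^ 2 * g - c * d ^ 2 = 0) :
    ∃ x y : Fin 3 → K, a = x 0 * y 0 ∧ 2 * b = x 0 * y 1 + x 1 * y 0 ∧ c = x 1 * y 1 ∧
      2 * d = x 0 * y 2 + x 2 * y 0 ∧ 2 * e = x 1 * y 2 + x 2 * y 1 ∧ g = x 2 * y 2 := by
  by_cases ha : a = 0
  · by_cases hc : c = 0
    · by_cases hg : g = 0
      · subst ha hc hg
        have : b = 0 ∨ d = 0 ∨ e = 0 := by simpa [or_assoc] using h
        rcases this with rfl | rfl | rfl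
        · exact ⟨![0, 0, 1], ![2 * d, 2 * e, 0], by simp⟩
        · exact ⟨![0, 1, 0], ![2 * b, 0, 2 * e], by simp⟩
        · exact ⟨![1, 0, 0], ![0, 2 * b, 2 * d], by simp⟩
      · obtain ⟨x, y, h₁, h₂, h₃, h₄, h₅, h₆⟩ := exists_ternary_quadratic_eq_mul_of_ne_zero
          (a := g) (b := e) (c := c) (d := d) (e := b) (g := a) hg (by linear_combination h)
        exact ⟨![x 2, x 1, x 0], ![y 2, y 1, y 0], by simpa using
          ⟨h₆, by rw [h₅, add_comm], h₃, by rw [h₄, add_comm], by rw [h₂, add_comm], h₁⟩⟩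
    · obtain ⟨x, y, h₁, h₂, h₃, h₄, h₅, h₆⟩ := exists_ternary_quadratic_eq_mul_of_ne_zero
        (a := c) (b := b) (c := a) (d := e) (e := d) (g := g) hc (by linear_combination h)
      exact ⟨![x 1, x 0, x 2], ![y 1, y 0, y 2], by simpa using
        ⟨h₃, by rw [h₂, add_comm], h₁, h₅, h₄, h₆⟩⟩
  · exact exists_ternary_quadratic_eq_mul_of_ne_zero ha h

/-- If `p` and `q` span a line on the surface, then the plane spanned by `p`, `q` and `d` cuts the
surface in that line and a residual conic. This is the discriminant of the conic. -/
def disc (S : SmoothCubic K V) (p q d : V) : K :=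
  4 * S.form p p d * S.form q q d * S.form d d d + 6 * S.form p q d * S.form p d d * S.form q d d
    - 3 * S.form p p d * S.form q d d ^ 2 - 4 * S.form p q d ^ 2 * S.form d d d
    - 3 * S.form q q d * S.form p d d ^ 2

/-- The derivative of `SmoothCubic.disc` at `d` in the direction `f`. -/
def discDeriv (S : SmoothCubic K V) (p q d f : V) : K :=
  4 * S.form p p f * S.form q q d * S.form d d d + 4 * S.form p p d * S.form q q f * S.form d d d
    + 12 * S.form p p d * S.form q q d * S.form d d f
    + 6 * S.form p q f * S.form p d d * S.form q d d
    + 12 * S.form p q d * S.form p d f * S.form q d d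
    + 12 * S.form p q d * S.form p d d * S.form q d f
    - 3 * S.form p p f * S.form q d d ^ 2
    - 12 * S.form p p d * S.form q d d * S.form q d f
    - 8 * S.form p q d * S.form p q f * S.form d d d - 12 * S.form p q d ^ 2 * S.form d d f
    - 3 * S.form q q f * S.form p d d ^ 2 - 12 * S.form q q d * S.form p d d * S.form p d f

theorem exists_isTritangent_of_disc_eq_zero [IsAlgClosed K] [CharZero K] (S : SmoothCubic K V)
    (hV : finrank K V = 4) {b : Basis (Fin 4) K V} (hb : Submodule.span K {b 0, b 1} ∈ S.lines)
    (hdisc : S.disc (b 0) (b 1) (b 2) = 0) :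
    S.discDeriv (b 0) (b 1) (b 2) (b 3) ≠ 0 ∧
    ∃ l, S.IsTritangent (LinearMap.ker (b.coord 3)) l ∧ l 0 = b.coord 2 := by
  have : FiniteDimensional K V := .of_finrank_eq_succ hV
  obtain ⟨x, y, h₁, h₂, h₃, h₄, h₅, h₆⟩ := exists_ternary_quadratic_eq_mul
    (a := 3 * S.form (b 0) (b 0) (b 2)) (b := 3 * S.form (b 0) (b 1) (b 2))
    (c := 3 * S.form (b 1) (b 1) (b 2)) (d := 3 / 2 * S.form (b 0) (b 2) (b 2))
    (e := 3 / 2 * S.form (b 1) (b 2) (b 2)) (g := S.form (b 2) (b 2) (b 2)) (by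
      rw [disc] at hdisc
      linear_combination 9 / 4 * hdisc)
  have hp : b 0 ∈ Submodule.span K {b 0, b 1} := Submodule.subset_span (by simp)
  have hq : b 1 ∈ Submodule.span K {b 0, b 1} := Submodule.subset_span (by simp)
  have hT {u v w : V} := S.form_eq_zero_of_mem hb.2 (u := u) (v := v) (w := w)
  have hP {v : V} (hv : b.coord 3 v = 0) :
      v = b.coord 0 v • b 0 + b.coord 1 v • b 1 + b.coord 2 v • b 2 := by
    conv_lhs => rw [← b.sum_repr v]
    rw [Fin.sum_univ_four]
    simp only [Basis.coord_apply] at hv ⊢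
    rw [hv, zero_smul, add_zero]
  have htri : S.IsTritangent (LinearMap.ker (b.coord 3)) ![b.coord 2,
      x 0 • b.coord 0 + x 1 • b.coord 1 + x 2 • b.coord 2,
      y 0 • b.coord 0 + y 1 • b.coord 1 + y 2 • b.coord 2] := by
    refine ⟨?_, fun v hv ↦ ?_⟩
    · have := Dual.finrank_ker_add_one_of_ne_zero (f := b.coord 3) fun h ↦ by
        simpa using DFunLike.congr_fun h (b 3)
      omega
    · rw [LinearMap.mem_ker] at hv
      have hv := hP hv
      generalize hz : b.coord 0 v = z at hv
      generalize ht : b.coord 1 v = t at hv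
      generalize hw : b.coord 2 v = w at hv
      simp only [Matrix.cons_val, LinearMap.add_apply, LinearMap.smul_apply, hz, ht, hw,
        smul_eq_mul]
      rw [hv]
      simp only [map_add, map_smul, LinearMap.add_apply, LinearMap.smul_apply, smul_eq_mul,
        hT hp hp hp, hT hp hp hq, hT hp hq hp, hT hq hp hp, hT hq hp hq, hT hp hq hq, hT hq hq hp,
        hT hq hq hq, S.swap_left (b 2) (b 0), S.swap_left (b 2) (b 1), S.swap_right _ (b 2) (b 0),
        S.swap_right _ (b 2) (b 1), S.swap_left (b 1) (b 0)]
      linear_combination w * (z ^ 2 * h₁ + z * t * h₂ + t ^ 2 * h₃ + z * w * h₄ + t * w * h₅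
        + w ^ 2 * h₆)
  refine ⟨fun hd ↦ ?_, _, htri, rfl⟩
  have hxy : LinearIndependent K ![x, y] := by
    refine LinearIndependent.pair_iff.2 fun s t h ↦ ?_
    have h (i) : s * x i + t * y i = 0 := congrFun h i
    refine ⟨?_, ?_⟩ <;> by_contra hst
    · refine absurd (htri.eq_of_ker_le_ker hV (i := 2) (j := 1) fun v hv ↦ ?_) (by decide)
      simp only [LinearMap.mem_ker, Matrix.cons_val, LinearMap.add_apply, LinearMap.smul_apply,
        smul_eq_mul] at hv ⊢
      refine mul_left_cancel₀ hst ?_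
      linear_combination b.coord 0 v * h 0 + b.coord 1 v * h 1 + b.coord 2 v * h 2 - t * hv
    · refine absurd (htri.eq_of_ker_le_ker hV (i := 1) (j := 2) fun v hv ↦ ?_) (by decide)
      simp only [LinearMap.mem_ker, Matrix.cons_val, LinearMap.add_apply, LinearMap.smul_apply,
        smul_eq_mul] at hv ⊢
      refine mul_left_cancel₀ hst ?_
      linear_combination b.coord 0 v * h 0 + b.coord 1 v * h 1 + b.coord 2 v * h 2 - s * hv
  have hκ : (x 1 * y 2 - y 1 * x 2) • b 0 + (x 2 * y 0 - y 2 * x 0) • b 1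
      + (x 0 * y 1 - y 0 * x 1) • b 2 ≠ 0 := by
    intro h
    apply crossProduct_ne_zero_iff_linearIndependent.2 hxy
    have h := Fintype.linearIndependent_iff.1 b.linearIndependent
      ![x 1 * y 2 - y 1 * x 2, x 2 * y 0 - y 2 * x 0, x 0 * y 1 - y 0 * x 1, 0]
      (by rw [Fin.sum_univ_four]; simpa using h)
    have h₀ := h 0
    have h₁ := h 1
    have h₂ := h 2
    simp only [Matrix.cons_val] at h₀ h₁ h₂
    rw [cross_apply, mul_comm (x 2) (y 1), h₀, mul_comm (x 0) (y 2), h₁, mul_comm (x 1) (y 0), h₂]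
    simp
  obtain ⟨w, hw⟩ := S.smooth _ hκ
  apply hw
  generalize hκ' : (x 1 * y 2 - y 1 * x 2) • b 0 + (x 2 * y 0 - y 2 * x 0) • b 1
      + (x 0 * y 1 - y 0 * x 1) • b 2 = κ
  have hκP : b.coord 3 κ = 0 := by simp [← hκ']
  have hκl (i : Fin 3) (hi : i ≠ 0)  : (![b.coord 2,
      x 0 • b.coord 0 + x 1 • b.coord 1 + x 2 • b.coord 2,
      y 0 • b.coord 0 + y 1 • b.coord 1 + y 2 • b.coord 2] : Fin 3 → Dual K V) i κ = 0 := by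
    fin_cases i
    · exact (hi rfl).elim
    all_goals
      simp [← hκ']
      ring
  have hκ₁ (u) (hu : b.coord 3 u = 0) : S.form κ κ u = 0 :=
    htri.form_eq_zero (show (1 : Fin 3) ≠ 2 by decide) hκP hu (hκl 1 (by decide))
      (hκl 2 (by decide))
  have hκ₂ : S.form κ κ (b 3) = 0 := by
    rw [← hκ']
    simp only [map_add, map_smul, LinearMap.add_apply, LinearMap.smul_apply, smul_eq_mul,
      S.swap_left (b 2) (b 0), S.swap_left (b 2) (b 1), S.swap_left (b 1) (b 0)]
    rw [discDeriv] at hd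
    rw [show S.form (b 0) (b 0) (b 2) = x 0 * y 0 / 3 by linear_combination h₁ / 3,
      show S.form (b 0) (b 1) (b 2) = (x 0 * y 1 + x 1 * y 0) / 6 by linear_combination h₂ / 6,
      show S.form (b 1) (b 1) (b 2) = x 1 * y 1 / 3 by linear_combination h₃ / 3,
      show S.form (b 0) (b 2) (b 2) = (x 0 * y 2 + x 2 * y 0) / 3 by linear_combination h₄ / 3,
      show S.form (b 1) (b 2) (b 2) = (x 1 * y 2 + x 2 * y 1) / 3 by linear_combination h₅ / 3,
      h₆] at hd
    linear_combination -3 * hd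
  rw [show w = (w - b.coord 3 w • b 3) + b.coord 3 w • b 3 by module, map_add, map_smul, hκ₂,
    hκ₁ _ (by simp), smul_zero, add_zero]

/-- A line meeting a given line lies in a plane whose residual conic is singular. -/
theorem disc_eq_zero [CharZero K] (S : SmoothCubic K V) {ℓ m : Submodule K V} (hℓ : ℓ ∈ S.lines)
    (hm : m ∈ S.lines) {p q d : V} (hp : p ∈ ℓ) (hq : q ∈ ℓ) {z₀ t₀ z₁ t₁ : K}
    (h₀ : z₀ ≠ 0 ∨ t₀ ≠ 0) (hr : z₀ • p + t₀ • q ∈ m) (he : z₁ • p + t₁ • q + d ∈ m) :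
    S.disc p q d = 0 := by
  have hT {u v w : V} := S.form_eq_zero_of_mem hℓ.2 (u := u) (v := v) (w := w)
  have h₁ := S.form_eq_zero_of_mem hm.2 hr hr he
  have h₂ := S.form_eq_zero_of_mem hm.2 hr he he
  have h₃ := S.form_eq_zero_of_mem hm.2 he he he
  simp only [map_add, map_smul, LinearMap.add_apply, LinearMap.smul_apply, smul_eq_mul,
    hT hp hp hp, hT hp hp hq, hT hp hq hp, hT hq hp hp, hT hq hp hq, hT hp hq hq, hT hq hq hp,
    hT hq hq hq, S.swap_left d p, S.swap_left d q, S.swap_right _ d p, S.swap_right _ d q,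
    S.swap_left q p, mul_zero, add_zero, zero_add] at h₁ h₂ h₃
  rw [disc]
  generalize S.form p p d = A at *
  generalize S.form p q d = B at *
  generalize S.form q q d = C at *
  generalize S.form p d d = D at *
  generalize S.form q d d = E at *
  generalize S.form d d d = G at *
  have h₂' : z₀ * (D + 2 * z₁ * A + 2 * t₁ * B) + t₀ * (E + 2 * z₁ * B + 2 * t₁ * C) = 0 := by
    linear_combination h₂
  have h₁' : z₀ ^ 2 * A + 2 * z₀ * t₀ * B + t₀ ^ 2 * C = 0 := by linear_combination h₁
  have h₃' : G + 3 * (z₁ ^ 2 * A + 2 * z₁ * t₁ * B + t₁ ^ 2 * C) + 3 * (z₁ * D + t₁ * E) = 0 := by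
    linear_combination h₃
  rcases h₀ with h | h <;> refine (mul_eq_zero_iff_left (pow_ne_zero 2 h)).1 ?_
  · linear_combination 4 * (A * C - B ^ 2) * z₀ ^ 2 * h₃' -
      3 * (E + 2 * z₁ * B + 2 * t₁ * C) ^ 2 * h₁' +
      (6 * B * z₀ * (E + 2 * z₁ * B + 2 * t₁ * C) + 6 * C * t₀ * (E + 2 * z₁ * B + 2 * t₁ * C) -
        3 * C * (z₀ * (D + 2 * z₁ * A + 2 * t₁ * B) + t₀ * (E + 2 * z₁ * B + 2 * t₁ * C))) * h₂'
  · linear_combination 4 * (A * C - B ^ 2) * t₀ ^ 2 * h₃' -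
      3 * (D + 2 * z₁ * A + 2 * t₁ * B) ^ 2 * h₁' +
      (6 * B * t₀ * (D + 2 * z₁ * A + 2 * t₁ * B) + 6 * A * z₀ * (D + 2 * z₁ * A + 2 * t₁ * B) -
        3 * A * (z₀ * (D + 2 * z₁ * A + 2 * t₁ * B) + t₀ * (E + 2 * z₁ * B + 2 * t₁ * C))) * h₂'

section discPoly

open Polynomial

/-- The discriminants of the residual conics in the planes containing `p` and `q`. -/
noncomputable def discPoly (S : SmoothCubic K V) (p q d f : V) : K[X] :=
  let A := C (S.form p p d) + C (S.form p p f) * X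
  let B := C (S.form p q d) + C (S.form p q f) * X
  let C' := C (S.form q q d) + C (S.form q q f) * X
  let D := C (S.form p d d) + C (2 * S.form p d f) * X + C (S.form p f f) * X ^ 2
  let E := C (S.form q d d) + C (2 * S.form q d f) * X + C (S.form q f f) * X ^ 2
  let G := C (S.form d d d) + C (3 * S.form d d f) * X + C (3 * S.form d f f) * X ^ 2 +
    C (S.form f f f) * X ^ 3
  C 4 * A * C' * G + C 6 * B * D * E - C 3 * A * E ^ 2 - C 4 * B ^ 2 * G - C 3 * C' * D ^ 2

theorem eval_discPoly (S : SmoothCubic K V) (p q d f : V) (s : K) :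
    (S.discPoly p q d f).eval s = S.disc p q (d + s • f) := by
  simp only [discPoly, disc, eval_add, eval_sub, eval_mul, eval_pow, eval_C, eval_X, map_add,
    map_smul, LinearMap.add_apply, LinearMap.smul_apply, smul_eq_mul, S.swap_left f d,
    S.swap_right _ f d]
  ring

theorem eval_derivative_discPoly (S : SmoothCubic K V) (p q d f : V) (s : K) :
    (derivative (S.discPoly p q d f)).eval s = S.discDeriv p q (d + s • f) f := by
  simp only [discPoly, discDeriv, derivative_sub, derivative_mul, derivative_pow,
    derivative_C, derivative_X, eval_add, eval_sub, eval_mul, eval_pow, eval_C, eval_X, map_add,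
    map_smul, LinearMap.add_apply, LinearMap.smul_apply, smul_eq_mul, S.swap_left f d,
    S.swap_right _ f d, eval_zero, eval_one]
  simp
  ring

theorem natDegree_discPoly (S : SmoothCubic K V) {p q f : V} (d : V) (hf : S.disc p q f ≠ 0) :
    (S.discPoly p q d f).natDegree = 5 := by
  rw [discPoly]
  compute_degree
  · rw [disc] at hf
    convert hf using 1
  all_goals simp

end discPoly

/-- Replace the third vector `b 2` of a basis by `b 2 + s • b 3`. -/
theorem exists_basis_add_smul (b : Basis (Fin 4) K V) (s : K) :
    ∃ b' : Basis (Fin 4) K V, b' 0 = b 0 ∧ b' 1 = b 1 ∧ b' 2 = b 2 + s • b 3 ∧ b' 3 = b 3 ∧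
      b'.coord 2 = b.coord 2 ∧ b'.coord 3 = b.coord 3 - s • b.coord 2 := by
  have h : b.coord 2 (s • b 3) = 0 := by simp
  refine ⟨b.map (LinearEquiv.transvection h), ?_, ?_, ?_, ?_, ?_, ?_⟩
  · simp [LinearMap.transvection.apply]
  · simp [LinearMap.transvection.apply]
  · simp [LinearMap.transvection.apply]
  · simp [LinearMap.transvection.apply]
  · ext v
    simp [LinearEquiv.transvection.symm_eq, LinearMap.transvection.apply]
  · ext v
    simp [LinearEquiv.transvection.symm_eq, LinearMap.transvection.apply]
    ring

theorem exists_basis_span_pair_eq (hV : finrank K V = 4) {ℓ : Submodule K V}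
    (hℓ : finrank K ℓ = 2) : ∃ b : Basis (Fin 4) K V, Submodule.span K {b 0, b 1} = ℓ := by
  have : FiniteDimensional K V := .of_finrank_eq_succ hV
  obtain ⟨W, hW⟩ := ℓ.exists_isCompl
  have hW' : finrank K W = 2 := by
    have := Submodule.finrank_add_eq_of_isCompl hW
    omega
  let c := finBasisOfFinrankEq K ℓ hℓ
  let b := (((c.prod (finBasisOfFinrankEq K W hW')).map
    (Submodule.prodEquivOfIsCompl ℓ W hW)).reindex finSumFinEquiv : Basis (Fin 4) K V)
  have h₀ : b 0 = c 0 := by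
    simp [b, show (finSumFinEquiv (m := 2) (n := 2)).symm 0 = .inl 0 from rfl]
  have h₁ : b 1 = c 1 := by
    simp [b, show (finSumFinEquiv (m := 2) (n := 2)).symm 1 = .inl 1 from rfl]
  refine ⟨b, ?_⟩
  rw [h₀, h₁]
  have h := congrArg (Submodule.map ℓ.subtype) c.span_eq
  rw [Submodule.map_span, Submodule.map_subtype_top] at h
  refine Eq.trans ?_ h
  congr 1
  ext x
  simp [Fin.exists_fin_two, eq_comm]

theorem exists_basis_disc_ne_zero [IsAlgClosed K] [CharZero K] (hV : finrank K V = 4)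
    (S : SmoothCubic K V) {ℓ : Submodule K V} (hℓ : ℓ ∈ S.lines) :
    ∃ b : Basis (Fin 4) K V, Submodule.span K {b 0, b 1} = ℓ ∧ S.disc (b 0) (b 1) (b 3) ≠ 0 := by
  obtain ⟨b, hb⟩ := exists_basis_span_pair_eq hV hℓ.1
  obtain ⟨s, hs⟩ : ∃ s, S.disc (b 0) (b 1) (b 2 + s • b 3) ≠ 0 := by
    by_contra! h
    have h0 : S.discPoly (b 0) (b 1) (b 2) (b 3) = 0 :=
      Polynomial.funext fun s ↦ by rw [eval_discPoly, h, Polynomial.eval_zero]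
    apply (S.exists_isTritangent_of_disc_eq_zero hV (b := b) (by rwa [hb])
      (by simpa using h 0)).1
    have := S.eval_derivative_discPoly (b 0) (b 1) (b 2) (b 3) 0
    rw [h0] at this
    simpa using this.symm
  obtain ⟨b', h₀, h₁, h₂, -⟩ := exists_basis_add_smul b s
  refine ⟨b'.reindex (Equiv.swap 2 3), ?_, ?_⟩
  · simp [Equiv.swap_apply_def, h₀, h₁, hb]
  · simpa [Equiv.swap_apply_def, h₀, h₁, h₂] using hs

theorem span_pair_eq_ker_inf_ker (b : Basis (Fin 4) K V) :
    Submodule.span K {b 0, b 1} = LinearMap.ker (b.coord 3) ⊓ LinearMap.ker (b.coord 2) := by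
  ext v
  rw [Submodule.mem_span_pair, Submodule.mem_inf, LinearMap.mem_ker, LinearMap.mem_ker]
  constructor
  · rintro ⟨x, y, rfl⟩
    simp
  · rintro ⟨h₃, h₂⟩
    refine ⟨b.coord 0 v, b.coord 1 v, ?_⟩
    conv_rhs => rw [← b.sum_repr v, Fin.sum_univ_four]
    rw [Basis.coord_apply] at h₂ h₃
    rw [h₂, h₃, zero_smul, zero_smul, add_zero, add_zero]
    rfl

theorem card_roots_discPoly [IsAlgClosed K] [CharZero K] [DecidableEq K] (hV : finrank K V = 4)
    (S : SmoothCubic K V) {b : Basis (Fin 4) K V} (hb : Submodule.span K {b 0, b 1} ∈ S.lines)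
    (hdisc : S.disc (b 0) (b 1) (b 3) ≠ 0) :
    (S.discPoly (b 0) (b 1) (b 2) (b 3)).roots.toFinset.card = 5 := by
  have hdeg := S.natDegree_discPoly (b 2) hdisc
  have h0 : S.discPoly (b 0) (b 1) (b 2) (b 3) ≠ 0 := by
    rintro h
    simp [h] at hdeg
  rw [Multiset.toFinset_card_of_nodup, ← hdeg, ← Polynomial.splits_iff_card_roots]
  · exact IsAlgClosed.splits _
  · rw [Multiset.nodup_iff_count_le_one]
    intro s
    rw [Polynomial.count_roots]
    by_contra! h
    obtain ⟨h₁, h₂⟩ := (Polynomial.one_lt_rootMultiplicity_iff_isRoot h0).1 h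
    rw [Polynomial.IsRoot.def, eval_discPoly] at h₁
    rw [Polynomial.IsRoot.def, eval_derivative_discPoly] at h₂
    obtain ⟨b', h₀, h₁, h₂, h₃, -⟩ := exists_basis_add_smul b s
    refine (S.exists_isTritangent_of_disc_eq_zero hV (b := b') ?_ ?_).1 ?_ <;> simp_all

theorem exists_isTritangent_ker [IsAlgClosed K] [CharZero K] (hV : finrank K V = 4)
    (S : SmoothCubic K V) {b : Basis (Fin 4) K V} (hb : Submodule.span K {b 0, b 1} ∈ S.lines)
    {s : K} (hs : S.disc (b 0) (b 1) (b 2 + s • b 3) = 0) :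
    ∃ l, S.IsTritangent (LinearMap.ker (b.coord 3 - s • b.coord 2)) l ∧
      LinearMap.ker (b.coord 3 - s • b.coord 2) ⊓ LinearMap.ker (l 0) =
        Submodule.span K {b 0, b 1} := by
  obtain ⟨b', h₀, h₁, h₂, h₃, h₄, h₅⟩ := exists_basis_add_smul b s
  obtain ⟨-, l, hl, hl'⟩ := S.exists_isTritangent_of_disc_eq_zero hV (b := b') (by rwa [h₀, h₁])
    (by rwa [h₀, h₁, h₂])
  rw [← h₀, ← h₁, span_pair_eq_ker_inf_ker, ← h₅]
  exact ⟨l, hl, by rw [hl']⟩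

/-- Each line of the surface is a side of a tritangent plane. -/
theorem exists_isTritangent [IsAlgClosed K] [CharZero K] (hV : finrank K V = 4)
    (S : SmoothCubic K V) {ℓ : Submodule K V} (hℓ : ℓ ∈ S.lines) :
    ∃ P l, S.IsTritangent P l ∧ P ⊓ LinearMap.ker (l 0) = ℓ := by
  obtain ⟨b, rfl, hdisc⟩ := S.exists_basis_disc_ne_zero hV hℓ
  obtain ⟨s, hs⟩ := IsAlgClosed.exists_root (S.discPoly (b 0) (b 1) (b 2) (b 3)) fun h ↦ by
    have := Polynomial.natDegree_eq_of_degree_eq_some h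
    simp [S.natDegree_discPoly _ hdisc] at this
  exact ⟨_, S.exists_isTritangent_ker hV hℓ (s := s) (by rwa [← eval_discPoly])⟩

theorem IsTritangent.exists_finset_other_sides [IsAlgClosed K] [CharZero K] (hV : finrank K V = 4)
    {S : SmoothCubic K V} {P : Submodule K V} {l : Fin 3 → Dual K V} (h : S.IsTritangent P l) :
    ∃ t : Finset (Submodule K V), t.card = 2 ∧ ∀ m, m ∈ t ↔
      m ∈ S.lines ∧ m ≠ P ⊓ LinearMap.ker (l 0) ∧ m ≤ P := by
  classical
  refine ⟨{P ⊓ LinearMap.ker (l 1), P ⊓ LinearMap.ker (l 2)}, Finset.card_pair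
    ((h.side_injective hV).ne (by decide)), fun m ↦ ?_⟩
  rw [Finset.mem_insert, Finset.mem_singleton]
  constructor
  · rintro (rfl | rfl) <;>
      exact ⟨h.side_mem_lines hV _, (h.side_injective hV).ne (by decide), inf_le_left⟩
  · rintro ⟨hm, hne, hle⟩
    obtain ⟨i, rfl⟩ := h.eq_side_of_le hV hm hle
    fin_cases i
    · exact (hne rfl).elim
    · exact .inl rfl
    · exact .inr rfl

/-- Each line of the surface meets ten other lines. -/
theorem ncard_inf_ne_bot [IsAlgClosed K] [CharZero K] (hV : finrank K V = 4)
    (S : SmoothCubic K V) {ℓ : Submodule K V} (hℓ : ℓ ∈ S.lines) :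
    {m ∈ S.lines | m ≠ ℓ ∧ m ⊓ ℓ ≠ ⊥}.ncard = 10 := by
  classical
  have : FiniteDimensional K V := .of_finrank_eq_succ hV
  obtain ⟨b, rfl, hdisc⟩ := S.exists_basis_disc_ne_zero hV hℓ
  have hcard := S.card_roots_discPoly hV hℓ hdisc
  set R := (S.discPoly (b 0) (b 1) (b 2) (b 3)).roots.toFinset
  have hR (s) : s ∈ R ↔ S.disc (b 0) (b 1) (b 2 + s • b 3) = 0 := by
    rw [Multiset.mem_toFinset, Polynomial.mem_roots', Polynomial.IsRoot.def, eval_discPoly]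
    refine and_iff_right fun h ↦ ?_
    simpa [h] using S.natDegree_discPoly (b 2) hdisc
  choose l hl hside using fun s hs ↦ S.exists_isTritangent_ker hV hℓ (s := s) ((hR s).1 hs)
  choose t ht hmem using fun s hs ↦ (hl s hs).exists_finset_other_sides hV
  simp only [hside] at hmem
  have : {m ∈ S.lines | m ≠ Submodule.span K {b 0, b 1} ∧ m ⊓ Submodule.span K {b 0, b 1} ≠ ⊥} =
      (R.attach.biUnion fun s ↦ t s.1 s.2 : Finset (Submodule K V)) := by
    ext m
    simp only [Set.mem_ofPred_eq, Finset.coe_biUnion, Set.mem_iUnion, SetLike.mem_coe, hmem,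
      Finset.mem_attach, true_and, Subtype.exists, exists_prop]
    constructor
    · rintro ⟨hm, hne, hmeet⟩
      obtain ⟨r, ⟨hrm, hr⟩, hr0⟩ := Submodule.ne_bot_iff _ |>.1 hmeet
      obtain ⟨z₀, t₀, rfl⟩ := Submodule.mem_span_pair.1 hr
      have h₀ : z₀ ≠ 0 ∨ t₀ ≠ 0 := by
        by_contra! h
        simp [h] at hr0
      obtain ⟨e, hem, he⟩ : ∃ e ∈ m, e ∉ Submodule.span K {b 0, b 1} := by
        by_contra! h
        exact hne (Submodule.eq_of_le_of_finrank_eq h (by rw [hm.1, hℓ.1]))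
      have hexp : e = b.coord 0 e • b 0 + b.coord 1 e • b 1 + b.coord 2 e • b 2 +
          b.coord 3 e • b 3 := by
        conv_lhs => rw [← b.sum_repr e, Fin.sum_univ_four]
        rfl
      have hdisc' {c : K} {d : V} (hc : c ≠ 0)
          (hed : e = b.coord 0 e • b 0 + b.coord 1 e • b 1 + c • d) :
          S.disc (b 0) (b 1) d = 0 := by
        refine S.disc_eq_zero hℓ hm (Submodule.subset_span (by simp))
          (Submodule.subset_span (by simp)) h₀ hrm (z₁ := c⁻¹ * b.coord 0 e)
          (t₁ := c⁻¹ * b.coord 1 e) ?_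
        convert m.smul_mem c⁻¹ hem
        conv_rhs => rw [hed]
        simp only [smul_add, smul_smul, inv_mul_cancel₀ hc, one_smul]
      have h2 : b.coord 2 e ≠ 0 := by
        intro h2
        have h3 : b.coord 3 e ≠ 0 := by
          intro h3
          apply he
          rw [span_pair_eq_ker_inf_ker]
          exact ⟨h3, h2⟩
        refine hdisc (hdisc' h3 ?_)
        rwa [h2, zero_smul, add_zero] at hexp
      refine ⟨(b.coord 2 e)⁻¹ * b.coord 3 e, ?_, hm, hne, ?_⟩
      · rw [hR]
        refine hdisc' h2 ?_
        rw [smul_add, smul_smul, mul_inv_cancel_left₀ h2, ← add_assoc]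
        exact hexp
      · rw [← inf_eq_left]
        refine Submodule.eq_of_le_of_finrank_le inf_le_left ?_
        have h₁ : m ⊓ Submodule.span K {b 0, b 1} <
            m ⊓ LinearMap.ker (b.coord 3 - ((b.coord 2 e)⁻¹ * b.coord 3 e) • b.coord 2) := by
          refine lt_of_le_not_ge (inf_le_inf_left m ?_) fun h ↦ he (h ⟨hem, ?_⟩).2
          · rw [Submodule.span_le, Set.pair_subset_iff]
            simp
          · simp only [SetLike.mem_coe, LinearMap.mem_ker, LinearMap.sub_apply,
              LinearMap.smul_apply, smul_eq_mul]
            field_simp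
            ring
        have h₂ := Submodule.finrank_lt_finrank_of_lt h₁
        have h₃ := Submodule.one_le_finrank_iff.2 hmeet
        rw [hm.1]
        omega
    · rintro ⟨s, hs, hm, hne, hle⟩
      refine ⟨hm, hne, ?_⟩
      obtain ⟨i, rfl⟩ := (hl s hs).eq_side_of_le hV hm hle
      rw [← hside s hs]
      exact (hl s hs).side_inf_side_ne_bot hV i 0
  rw [this, Set.ncard_coe_finset, Finset.card_biUnion]
  · simp [ht, hcard]
  · intro s _ s' _ hne
    rw [Function.onFun, Finset.disjoint_left]
    intro m hm hm'
    rw [hmem] at hm hm'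
    refine hm.2.1 (Submodule.eq_of_le_of_finrank_eq (fun v hv ↦ ?_) (by rw [hm.1.1, hℓ.1]))
    have h₁ := hm.2.2 hv
    have h₂ := hm'.2.2 hv
    rw [span_pair_eq_ker_inf_ker]
    simp only [Submodule.mem_inf, LinearMap.mem_ker, LinearMap.sub_apply, LinearMap.smul_apply,
      smul_eq_mul] at h₁ h₂ ⊢
    have h₃ : b.coord 2 v = 0 := by
      refine mul_left_cancel₀ (sub_ne_zero.2 fun h ↦ hne (Subtype.ext h) : s.1 - s'.1 ≠ 0) ?_
      linear_combination h₂ - h₁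
    exact ⟨by rw [h₃] at h₁; linear_combination h₁, h₃⟩

/-- The **Cayley–Salmon theorem**: a smooth cubic surface contains exactly 27 lines. -/
theorem ncard_lines [IsAlgClosed K] [CharZero K] (hV : finrank K V = 4) (S : SmoothCubic K V) :
    S.lines.ncard = 27 := by
  classical
  obtain ⟨ℓ, hℓ⟩ := S.lines_nonempty hV
  obtain ⟨P, l, h, -⟩ := S.exists_isTritangent hV hℓ
  set side := fun i ↦ P ⊓ LinearMap.ker (l i)
  have hinj : Function.Injective side := h.side_injective hV
  let t : Finset (Submodule K V) := Finset.univ.image side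
  have ht : t.card = 3 := by rw [Finset.card_image_of_injective _ hinj, Finset.card_fin]
  have hmem_t (m) : m ∈ t ↔ m ∈ S.lines ∧ m ≤ P := by
    simp only [t, Finset.mem_image, Finset.mem_univ, true_and]
    constructor
    · rintro ⟨i, rfl⟩
      exact ⟨h.side_mem_lines hV i, inf_le_left⟩
    · rintro ⟨hm, hle⟩
      obtain ⟨i, rfl⟩ := h.eq_side_of_le hV hm hle
      exact ⟨i, rfl⟩
  have hM (i : Fin 3) : ∃ M : Finset (Submodule K V), M.card = 10 ∧
      ∀ m, m ∈ M ↔ m ∈ S.lines ∧ m ≠ side i ∧ m ⊓ side i ≠ ⊥ := by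
    have hcard := S.ncard_inf_ne_bot hV (h.side_mem_lines hV i)
    have hfin := Set.finite_of_ncard_ne_zero (hcard.trans_ne (by norm_num))
    refine ⟨hfin.toFinset, by rw [← Set.ncard_eq_toFinset_card _ hfin, hcard], fun m ↦ ?_⟩
    rw [hfin.mem_toFinset]
    rfl
  choose M hcard hM using hM
  have hsdiff (i) : (M i \ t).card = 8 := by
    have : t ∩ M i = t.erase (side i) := by
      ext m
      rw [Finset.mem_inter, Finset.mem_erase, hM]
      refine ⟨fun ⟨hm, _, hne, _⟩ ↦ ⟨hne, hm⟩, fun ⟨hne, hm⟩ ↦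
        ⟨hm, ((hmem_t m).1 hm).1, hne, ?_⟩⟩
      obtain ⟨j, -, rfl⟩ := Finset.mem_image.1 hm
      exact h.side_inf_side_ne_bot hV j i
    rw [Finset.card_sdiff, this, Finset.card_erase_of_mem (Finset.mem_image_of_mem _
      (Finset.mem_univ i)), hcard, ht]
  have hnot {i m} (hm : m ∈ M i \ t) : m ∈ S.lines ∧ ¬ m ≤ P := by
    rw [Finset.mem_sdiff, hmem_t, hM] at hm
    tauto
  have hlines : S.lines = (t ∪ Finset.univ.biUnion fun i ↦ M i \ t : Finset (Submodule K V)) := by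
    ext m
    simp only [Finset.mem_coe, Finset.mem_union, Finset.mem_biUnion, Finset.mem_univ, true_and]
    constructor
    · intro hm
      by_cases hle : m ≤ P
      · exact .inl ((hmem_t m).2 ⟨hm, hle⟩)
      · obtain ⟨i, hi, -⟩ := h.existsUnique_inf_ne_bot hV hm hle
        refine .inr ⟨i, Finset.mem_sdiff.2 ⟨(hM i m).2 ⟨hm, ?_, hi⟩, fun hmt ↦ hle
          ((hmem_t m).1 hmt).2⟩⟩
        rintro rfl
        exact hle inf_le_left
    · rintro (hm | ⟨i, hm⟩)
      · exact ((hmem_t m).1 hm).1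
      · exact (hnot hm).1
  rw [hlines, Set.ncard_coe_finset, Finset.card_union_of_disjoint, ht, Finset.card_biUnion]
  · simp [hsdiff]
  · intro i _ j _ hij
    rw [Function.onFun, Finset.disjoint_left]
    intro m hi hj
    obtain ⟨hm, hle⟩ := hnot hi
    exact hij ((h.existsUnique_inf_ne_bot hV hm hle).unique
      ((hM i m).1 (Finset.mem_sdiff.1 hi).1).2.2 ((hM j m).1 (Finset.mem_sdiff.1 hj).1).2.2)
  · rw [Finset.disjoint_biUnion_right]
    exact fun i _ ↦ Finset.disjoint_sdiff

section ofPolynomial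

open MvPolynomial

theorem _root_.MvPolynomial.pderiv_pderiv_comm {σ R : Type*} [CommRing R] (i j : σ)
    (F : MvPolynomial σ R) : pderiv i (pderiv j F) = pderiv j (pderiv i F) := by
  classical
  induction F using MvPolynomial.induction_on with
  | C a => simp
  | add p q hp hq => simp [hp, hq]
  | mul_X p k hp =>
    have (a b : σ) : pderiv a (pderiv (R := R) b (X k)) = 0 := by
      rw [pderiv_X, Pi.single_apply]
      split_ifs <;> simp
    simp only [Derivation.leibniz, smul_eq_mul, map_add, hp, this]
    ring

theorem _root_.MvPolynomial.IsHomogeneous.sum_mul_eval_pderiv {σ R : Type*} [Fintype σ] [CommRing R]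
    {F : MvPolynomial σ R} {n : ℕ} (hF : F.IsHomogeneous n) (v : σ → R) :
    ∑ i, v i * eval v (pderiv i F) = n * eval v F := by
  simpa using congrArg (eval v) hF.sum_X_mul_pderiv

theorem _root_.MvPolynomial.IsHomogeneous.eval_eq_eval_zero {σ R : Type*} [CommRing R]
    {F : MvPolynomial σ R} (hF : F.IsHomogeneous 0) (v : σ → R) : eval v F = eval 0 F := by
  rw [totalDegree_eq_zero_iff_eq_C.1 ((totalDegree_zero_iff_isHomogeneous _).2 hF), eval_C, eval_C]

/-- The polar form of a cubic form. -/
noncomputable def polarForm (F : MvPolynomial (Fin 4) K) :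
    (Fin 4 → K) →ₗ[K] (Fin 4 → K) →ₗ[K] (Fin 4 → K) →ₗ[K] K :=
  ∑ i, ∑ j, ∑ k, (eval 0 (pderiv i (pderiv j (pderiv k F))) / 6) •
    (LinearMap.proj i).smulRight ((LinearMap.proj j).smulRight (LinearMap.proj k))

theorem polarForm_apply (F : MvPolynomial (Fin 4) K) (u v w : Fin 4 → K) :
    polarForm F u v w = ∑ i, ∑ j, ∑ k,
      eval 0 (pderiv i (pderiv j (pderiv k F))) / 6 * (u i * (v j * w k)) := by
  simp [polarForm]

theorem polarForm_self_left [CharZero K] {F : MvPolynomial (Fin 4) K} (hF : F.IsHomogeneous 3)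
    (v w : Fin 4 → K) : polarForm F v v w = (∑ k, w k * eval v (pderiv k F)) / 3 := by
  have h (k : Fin 4) : 2 * eval v (pderiv k F) =
      ∑ j, ∑ i, v j * (v i * eval 0 (pderiv i (pderiv j (pderiv k F)))) := by
    have h₁ := (hF.pderiv (i := k)).sum_mul_eval_pderiv v
    norm_num at h₁
    rw [← h₁]
    refine Finset.sum_congr rfl fun j _ ↦ ?_
    have h₂ := (hF.pderiv (i := k)).pderiv (i := j) |>.sum_mul_eval_pderiv v
    norm_num at h₂
    rw [← h₂, Finset.mul_sum]
    refine Finset.sum_congr rfl fun i _ ↦ ?_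
    rw [((hF.pderiv (i := k)).pderiv (i := j)).pderiv (i := i) |>.eval_eq_eval_zero v]
  have h' (k : Fin 4) : w k * eval v (pderiv k F) / 3 =
      ∑ i, ∑ j, eval 0 (pderiv i (pderiv j (pderiv k F))) / 6 * (v i * (v j * w k)) := by
    rw [show w k * eval v (pderiv k F) / 3 = w k * (2 * eval v (pderiv k F)) / 6 by ring, h,
      Finset.sum_comm, Finset.mul_sum, Finset.sum_div]
    refine Finset.sum_congr rfl fun j _ ↦ ?_
    rw [Finset.mul_sum, Finset.sum_div]
    exact Finset.sum_congr rfl fun i _ ↦ by ring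
  rw [polarForm_apply, Finset.sum_div, Finset.sum_congr rfl fun k _ ↦ h' k]
  exact (Finset.sum_comm.trans (Finset.sum_congr rfl fun i _ ↦ Finset.sum_comm)).symm

theorem polarForm_self [CharZero K] {F : MvPolynomial (Fin 4) K} (hF : F.IsHomogeneous 3)
    (v : Fin 4 → K) : polarForm F v v v = eval v F := by
  rw [polarForm_self_left hF, hF.sum_mul_eval_pderiv]
  push_cast
  ring

/-- The smooth cubic surface defined by a polynomial. -/
noncomputable def ofPolynomial [CharZero K] (F : MvPolynomial (Fin 4) K) (hF : F.IsHomogeneous 3)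
    (hsmooth : ∀ v : Fin 4 → K, v ≠ 0 → ∃ i, eval v (pderiv i F) ≠ 0) :
    SmoothCubic K (Fin 4 → K) where
  form := polarForm F
  swap_left u v w := by
    rw [polarForm_apply, polarForm_apply, Finset.sum_comm]
    refine Finset.sum_congr rfl fun i _ ↦ Finset.sum_congr rfl fun j _ ↦
      Finset.sum_congr rfl fun k _ ↦ ?_
    rw [pderiv_pderiv_comm i j]
    ring
  swap_right u v w := by
    rw [polarForm_apply, polarForm_apply]
    refine Finset.sum_congr rfl fun i _ ↦ ?_
    rw [Finset.sum_comm]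
    refine Finset.sum_congr rfl fun j _ ↦ Finset.sum_congr rfl fun k _ ↦ ?_
    rw [pderiv_pderiv_comm j k]
    ring
  smooth v hv := by
    obtain ⟨i, hi⟩ := hsmooth v hv
    refine ⟨Pi.single i 1, ?_⟩
    rw [polarForm_self_left hF]
    simpa [Pi.single_apply] using hi

end ofPolynomial

end SmoothCubic

end CubicSurfaces

open MvPolynomial

/-- Cayley–Salmon: every smooth complex cubic surface contains exactly 27 lines,
i.e. for a smooth homogeneous cubic form `F` over `ℂ` there are exactly 27
two-dimensional linear subspaces of `ℂ⁴` on which `F` vanishes identically. -/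
theorem cayley_salmon (F : MvPolynomial (Fin 4) ℂ) (hF : F.IsHomogeneous 3)
    (hsmooth : ∀ v : Fin 4 → ℂ, v ≠ 0 → ∃ i : Fin 4, eval v (pderiv i F) ≠ 0) :
    Nat.card {ℓ : Submodule ℂ (Fin 4 → ℂ) //
      Module.finrank ℂ ℓ = 2 ∧ ∀ v ∈ ℓ, eval v F = 0} = 27 := by
  have h := (SmoothCubic.ofPolynomial F hF hsmooth).ncard_lines (by simp)
  simp only [SmoothCubic.lines, SmoothCubic.ofPolynomial, SmoothCubic.polarForm_self hF] at h
  rwa [← Nat.card_coe_set_eq] at h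
end

section
/- There exist a nonzero homogeneous polynomial Δ with integer coefficients in 20 variables (indexed by the 20 monomials of degree 3 in X₀, X₁, X₂, X₃) and a finite set S of prime numbers with the following property: for every algebraically closed field K whose characteristic is zero or does not lie in S, and every homogeneous cubic form F over K, one has Δ(coefficients of F) = 0 if and only if F is not smooth. -/
open MvPolynomial

namespace MvPolynomial

section Homogeneous

variable {σ R : Type*} [CommRing R]

/-- The substitution `Xᵢ ↦ Xᵢ T`, which sorts the terms of a polynomial by total degree. -/
noncomputable def gradingHom (σ R : Type*) [CommRing R] :
    MvPolynomial σ R →ₐ[R] Polynomial (MvPolynomial σ R) :=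
  aeval fun i => Polynomial.C (X i) * Polynomial.X

lemma gradingHom_monomial (d : σ →₀ ℕ) (r : R) :
    gradingHom σ R (monomial d r) = Polynomial.monomial d.degree (monomial d r) := by
  rw [gradingHom, aeval_monomial, ← Polynomial.C_mul_X_pow_eq_monomial, Finsupp.prod]
  simp only [mul_pow, Finset.prod_mul_distrib, Finset.prod_pow_eq_pow_sum]
  rw [monomial_eq, map_mul, ← mul_assoc, Finsupp.degree, Finsupp.prod, map_prod]
  simp only [map_pow]
  rfl

lemma coeff_gradingHom (p : MvPolynomial σ R) (n : ℕ) :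
    (gradingHom σ R p).coeff n = homogeneousComponent n p := by
  induction p using MvPolynomial.induction_on' with
  | add p q hp hq => simp [hp, hq]
  | monomial d r =>
    rw [gradingHom_monomial, Polynomial.coeff_monomial,
      homogeneousComponent_of_mem (isHomogeneous_monomial r rfl)]
    simp only [eq_comm]

lemma IsHomogeneous.gradingHom_eq {p : MvPolynomial σ R} {n : ℕ} (hp : p.IsHomogeneous n) :
    gradingHom σ R p = Polynomial.monomial n p := by
  ext1 k
  rw [coeff_gradingHom, homogeneousComponent_of_mem hp, Polynomial.coeff_monomial]
  simp only [eq_comm]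

/-- A divisor of a nonzero homogeneous polynomial over a domain is homogeneous. -/
lemma IsHomogeneous.of_dvd [IsDomain R] {p q : MvPolynomial σ R} {n : ℕ}
    (hq : q.IsHomogeneous n) (hq0 : q ≠ 0) (h : p ∣ q) : ∃ k, p.IsHomogeneous k := by
  obtain ⟨r, rfl⟩ := h
  have key := hq.gradingHom_eq
  rw [map_mul] at key
  have hne : gradingHom σ R p * gradingHom σ R r ≠ 0 := by
    rw [key]; simpa using hq0
  have hp0 := left_ne_zero_of_mul hne
  have hr0 := right_ne_zero_of_mul hne
  have h1 := Polynomial.natDegree_mul hp0 hr0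
  have h2 := Polynomial.natTrailingDegree_mul hp0 hr0
  rw [key, Polynomial.natDegree_monomial_eq n hq0] at h1
  rw [key, Polynomial.natTrailingDegree_monomial hq0] at h2
  have h3 := Polynomial.natTrailingDegree_le_natDegree (gradingHom σ R p)
  have h4 := Polynomial.natTrailingDegree_le_natDegree (gradingHom σ R r)
  refine ⟨(gradingHom σ R p).natDegree, ?_⟩
  suffices ∀ i ∈ Finset.range (p.totalDegree + 1),
      (homogeneousComponent i p).IsHomogeneous (gradingHom σ R p).natDegree by
    have hsum := IsHomogeneous.sum _ _ _ this
    rwa [sum_homogeneousComponent] at hsum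
  intro i _
  by_cases hi : i = (gradingHom σ R p).natDegree
  · exact hi ▸ homogeneousComponent_isHomogeneous i p
  · rw [← coeff_gradingHom]
    suffices (gradingHom σ R p).coeff i = 0 by rw [this]; exact isHomogeneous_zero _ _ _
    rcases lt_or_gt_of_ne hi with hi | hi
    · exact Polynomial.coeff_eq_zero_of_lt_natTrailingDegree (by omega)
    · exact Polynomial.coeff_eq_zero_of_natDegree_lt hi

end Homogeneous

end MvPolynomial

/-- A prime ideal of `D[X]`, with `D` factorial, that contains no nonzero constant is principal. -/
lemma Polynomial.isPrincipal_of_forall_C_mem {D : Type*} [CommRing D] [IsDomain D]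
    [UniqueFactorizationMonoid D] (P : Ideal (Polynomial D)) [hP : P.IsPrime]
    (h : ∀ d, Polynomial.C d ∈ P → d = 0) : ∃ f, P = Ideal.span {f} := by
  by_cases hP0 : P = ⊥
  · exact ⟨0, by simp [hP0]⟩
  obtain ⟨f, hfP, hf⟩ := hP.exists_mem_prime_of_ne_bot hP0
  refine ⟨f, le_antisymm (fun g hg => ?_) ((Ideal.span_singleton_le_iff_mem P).2 hfP)⟩
  have hdeg : f.natDegree ≠ 0 := fun h0 => hf.ne_zero <| by
    rw [Polynomial.eq_C_of_natDegree_eq_zero h0] at hfP ⊢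
    rw [h _ hfP, map_zero]
  let K := FractionRing D
  let φ := algebraMap D K
  have hinj : Function.Injective (Polynomial.map φ) :=
    Polynomial.map_injective _ (IsFractionRing.injective D K)
  have clear (u : Polynomial K) : ∃ b : D, b ≠ 0 ∧ ∃ v : Polynomial D,
      v.map φ = Polynomial.C (φ b) * u := by
    obtain ⟨b, hb, hv⟩ := IsLocalization.integerNormalization_spec (nonZeroDivisors D) u
    refine ⟨b, nonZeroDivisors.ne_zero hb, _, hv.trans ?_⟩
    rw [← Polynomial.smul_eq_C_mul, algebraMap_smul]
  have hirr : Irreducible (f.map φ) :=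
    ((hf.irreducible.isPrimitive hdeg).irreducible_iff_irreducible_map_fraction_map).1
      hf.irreducible
  rw [Ideal.mem_span_singleton]
  by_cases hdvd : f.map φ ∣ g.map φ
  · obtain ⟨q, hq⟩ := hdvd
    obtain ⟨b, hb, v, hv⟩ := clear q
    have : f * v = Polynomial.C b * g := hinj <| by
      rw [Polynomial.map_mul, Polynomial.map_mul, hv, hq, Polynomial.map_C]; ring
    refine (hf.dvd_or_dvd (Dvd.intro _ this)).resolve_left fun hfb => hdeg ?_
    have := Polynomial.natDegree_le_of_dvd hfb (by simpa using hb)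
    simpa using this
  · obtain ⟨u, v, huv⟩ := (hirr.coprime_iff_not_dvd).2 hdvd
    obtain ⟨b, hb, u', hu⟩ := clear u
    obtain ⟨c, hc, v', hv⟩ := clear v
    have : Polynomial.C c * u' * f + Polynomial.C b * v' * g = Polynomial.C (b * c) := hinj <| by
      simp only [Polynomial.map_add, Polynomial.map_mul, Polynomial.map_C, hu, hv, map_mul]
      linear_combination (Polynomial.C (φ b) * Polynomial.C (φ c)) * huv
    exact absurd (h _ (this ▸ P.add_mem (P.mul_mem_left _ hfP) (P.mul_mem_left _ hg)))
      (mul_ne_zero hb hc)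

namespace MvPolynomial

section Derivations

variable {σ R : Type*} [CommRing R]

/-- A prime ideal of a factorial polynomial ring that contains no nonzero polynomial independent
of one chosen variable is principal. -/
lemma isPrincipal_of_pderiv [IsDomain R] [UniqueFactorizationMonoid R] (i : σ)
    (P : Ideal (MvPolynomial σ R)) [P.IsPrime] (h : ∀ p ∈ P, pderiv i p = 0 → p = 0) :
    ∃ f, P = Ideal.span {f} := by
  classical
  let e : MvPolynomial σ R ≃ₐ[R] Polynomial (MvPolynomial {k // k ≠ i} R) :=
    (renameEquiv R (Equiv.optionSubtypeNe i).symm).trans (optionEquivLeft R _)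
  have he (d : MvPolynomial {k // k ≠ i} R) : e (rename Subtype.val d) = Polynomial.C d := by
    induction d using MvPolynomial.induction_on with
    | C a => simp [e]
    | add p q hp hq => simp only [map_add, hp, hq]
    | mul_X p k hp =>
      rw [map_mul, map_mul, hp, map_mul, rename_X]
      simp [e, Equiv.optionSubtypeNe_symm_of_ne k.2]
  obtain ⟨f, hf⟩ := Polynomial.isPrincipal_of_forall_C_mem (P.comap e.symm) fun d hd => by
    rw [Ideal.mem_comap, ← he, AlgEquiv.symm_apply_apply] at hd
    refine (map_eq_zero_iff _ (rename_injective _ Subtype.val_injective)).1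
      (h _ hd (pderiv_eq_zero_of_notMem_vars fun hi => ?_))
    obtain ⟨k, -, hk⟩ := mem_vars_rename _ _ hi
    exact k.2 hk
  refine ⟨e.symm f, le_antisymm (fun g hg => ?_) ?_⟩
  · have : e g ∈ P.comap e.symm := by simpa using hg
    rw [hf, Ideal.mem_span_singleton] at this
    rw [Ideal.mem_span_singleton]
    simpa using map_dvd e.symm this
  · rw [Ideal.span_singleton_le_iff_mem, ← Ideal.mem_comap, hf]
    exact Ideal.mem_span_singleton_self f

lemma pderiv_aeval {τ : Type*} [Fintype σ] (k : τ) (φ : σ → MvPolynomial τ R)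
    (p : MvPolynomial σ R) :
    pderiv k (aeval φ p) = ∑ s, aeval φ (pderiv s p) * pderiv k (φ s) := by
  classical
  induction p using MvPolynomial.induction_on with
  | C a => simp [← algebraMap_eq]
  | add p q hp hq => simp only [map_add, hp, hq, add_mul, Finset.sum_add_distrib]
  | mul_X p t hp =>
    simp only [map_mul, aeval_X, Derivation.leibniz, hp, pderiv_X, smul_eq_mul, map_add, add_mul,
      Finset.sum_add_distrib, Pi.single_apply]
    simp [Finset.mul_sum, mul_assoc]

lemma pderiv_comm (i j : σ) (p : MvPolynomial σ R) :
    pderiv i (pderiv j p) = pderiv j (pderiv i p) := by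
  classical
  induction p using MvPolynomial.induction_on with
  | C a => simp
  | add p q hp hq => simp [hp, hq]
  | mul_X p t hp =>
    simp only [Derivation.leibniz, pderiv_X, smul_eq_mul, map_add, hp, Pi.single_apply]
    split_ifs <;> simp <;> ring

lemma totalDegree_pderiv_lt {i : σ} {p : MvPolynomial σ R} (h : pderiv i p ≠ 0) :
    (pderiv i p).totalDegree < p.totalDegree := by
  have hlt : ∀ d ∈ (pderiv i p).support, d.degree < p.totalDegree := fun d hd => by
    rw [mem_support_iff, coeff_pderiv] at hd
    have := le_totalDegree (mem_support_iff.2 (left_ne_zero_of_mul hd))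
    have h2 : (d + Finsupp.single i 1).degree = d.degree + 1 := by simp
    change (d + Finsupp.single i 1).degree ≤ _ at this
    omega
  obtain ⟨d, hd⟩ := support_nonempty.2 h
  exact (Finset.sup_lt_iff (bot_le.trans_lt (hlt d hd))).2 hlt

lemma notMem_vars_of_pderiv_eq_zero [IsDomain R] [CharZero R] {i : σ} {p : MvPolynomial σ R}
    (h : pderiv i p = 0) : i ∉ p.vars := by
  rw [mem_vars_iff_mem_support]
  rintro ⟨d, hd, hi⟩
  have h1 := coeff_pderiv (i := i) p (d - Finsupp.single i 1)
  have hle : Finsupp.single i 1 ≤ d := by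
    rw [Finsupp.single_le_iff]
    exact Nat.one_le_iff_ne_zero.2 (Finsupp.mem_support_iff.1 hi)
  rw [h, coeff_zero, tsub_add_cancel_of_le hle] at h1
  exact mul_ne_zero (mem_support_iff.1 hd) (Nat.cast_add_one_ne_zero _) h1.symm

/-- A Jacobian criterion for the injectivity of a substitution that fixes all variables `s`
except `a₀` and the `a i`, on polynomials independent of `a₀`. -/
lemma eq_zero_of_aeval_eq_zero_of_jacobian {τ κ : Type*} [IsDomain R] [CharZero R] [Fintype σ]
    [Fintype κ] [DecidableEq κ] (φ : σ → MvPolynomial (σ ⊕ τ) R) (a₀ : σ) (a : κ → σ)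
    (ha : Function.Injective a) (b : κ → τ)
    (hφ : ∀ s, s ≠ a₀ → (∀ i, s ≠ a i) → φ s = X (Sum.inl s))
    (hJ : (Matrix.of fun i k => pderiv (Sum.inr (b k)) (φ (a i))).det ≠ 0)
    (p : MvPolynomial σ R) (hp₀ : pderiv a₀ p = 0) (hp : aeval φ p = 0) : p = 0 := by
  classical
  induction hn : p.totalDegree using Nat.strong_induction_on generalizing p with
  | _ n ih =>
  have hJp (k : κ) :
      ∑ i, aeval φ (pderiv (a i) p) * pderiv (Sum.inr (b k)) (φ (a i)) = 0 := by
    have h := pderiv_aeval (Sum.inr (b k)) φ p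
    rw [hp, map_zero] at h
    rw [h, ← Finset.sum_image (g := a) (s := Finset.univ)
      (f := fun s => aeval φ (pderiv s p) * pderiv (Sum.inr (b k)) (φ s)) ha.injOn]
    refine Finset.sum_subset (Finset.subset_univ _) fun s _ hs => ?_
    by_cases h0 : s = a₀
    · simp [h0, hp₀]
    · rw [hφ s h0 fun i hi => hs (hi ▸ Finset.mem_image_of_mem a (Finset.mem_univ i)),
        pderiv_X_of_ne (by simp), mul_zero]
  have hv := Matrix.eq_zero_of_vecMul_eq_zero hJ
    (v := fun i => aeval φ (pderiv (a i) p)) (by ext1 k; exact hJp k)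
  have hd (i : κ) : pderiv (a i) p = 0 := by
    by_contra hne
    exact hne (ih _ (hn ▸ totalDegree_pderiv_lt hne) _ (by rw [pderiv_comm, hp₀, map_zero])
      (congrFun hv i) rfl)
  have hren : aeval φ p = rename Sum.inl p := by
    refine hom_congr_vars (f₁ := (aeval φ).toRingHom) (f₂ := (rename Sum.inl).toRingHom)
      (by ext; simp) (fun s hs _ => ?_) rfl
    have hsa (i : κ) : s ≠ a i := fun h => notMem_vars_of_pderiv_eq_zero (hd i) (h ▸ hs)
    have hs₀ : s ≠ a₀ := fun h => notMem_vars_of_pderiv_eq_zero hp₀ (h ▸ hs)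
    simp [hφ s hs₀ hsa]
  exact (map_eq_zero_iff _ (rename_injective _ Sum.inl_injective)).1 (hren ▸ hp)

end Derivations

end MvPolynomial

namespace MvPolynomial

section Forms

variable {ι : Type*} [Fintype ι] {m : ℕ}

/-- Exponents of the monomials of degree `m` in the variables `ι`. -/
abbrev Exponent (ι : Type*) [Fintype ι] (m : ℕ) := {d : ι →₀ ℕ // ∑ i, d i = m}

instance : Finite (Exponent ι m) := by
  classical
  refine ((Finset.finsuppAntidiag (Finset.univ : Finset ι) m).finite_toSet.subset
    fun d hd => ?_).to_subtype
  exact Finset.mem_finsuppAntidiag.2 ⟨hd, Finset.subset_univ _⟩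

noncomputable instance : Fintype (Exponent ι m) := Fintype.ofFinite _

/-- The `i`-th form of degree `m` in the family with coefficients `c`. -/
noncomputable def formOf {R : Type*} [CommSemiring R] (c : ι × Exponent ι m → R) (i : ι) :
    MvPolynomial ι R :=
  ∑ d, monomial d.1 (c (i, d))

section

variable {R S : Type*} [CommSemiring R] [CommSemiring S]

lemma formOf_isHomogeneous (c : ι × Exponent ι m → R) (i : ι) : (formOf c i).IsHomogeneous m :=
  IsHomogeneous.sum _ _ _ fun d _ =>
    isHomogeneous_monomial _ ((Finsupp.degree_eq_sum d.1).trans d.2)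

lemma eval_sum_monomial (c : Exponent ι m → R) (v : ι → R) :
    eval v (∑ d, monomial d.1 (c d)) = ∑ d, c d * ∏ k, v k ^ d.1 k := by
  simp only [map_sum, eval_monomial]
  refine Finset.sum_congr rfl fun d _ => ?_
  rw [Finsupp.prod_fintype _ _ (by simp)]

lemma eval_formOf (c : ι × Exponent ι m → R) (i : ι) (v : ι → R) :
    eval v (formOf c i) = ∑ d, c (i, d) * ∏ k, v k ^ d.1 k :=
  eval_sum_monomial (fun d => c (i, d)) v

lemma map_formOf (f : R →+* S) (c : ι × Exponent ι m → R) (i : ι) :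
    map f (formOf c i) = formOf (f ∘ c) i := by
  simp [formOf, map_monomial]

lemma IsHomogeneous.eq_sum_monomial {p : MvPolynomial ι R} (hp : p.IsHomogeneous m) :
    p = ∑ d : Exponent ι m, monomial d.1 (coeff d.1 p) := by
  classical
  ext e
  simp only [coeff_sum, coeff_monomial]
  by_cases he : ∑ i, e i = m
  · rw [Finset.sum_eq_single ⟨e, he⟩] <;> aesop
  · rw [hp.coeff_eq_zero (by rwa [Finsupp.degree_eq_sum]), Finset.sum_eq_zero]
    rintro d -
    rw [if_neg]
    rintro rfl
    exact he d.2

lemma IsHomogeneous.eval_eq {p : MvPolynomial ι R} (hp : p.IsHomogeneous m) (v : ι → R) :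
    eval v p = ∑ d : Exponent ι m, coeff d.1 p * ∏ k, v k ^ d.1 k := by
  conv_lhs => rw [hp.eq_sum_monomial]
  exact eval_sum_monomial (fun d => coeff d.1 p) v

end

lemma prod_pow_single {R : Type*} [CommMonoid R] (v : ι → R) (j : ι) (n : ℕ) :
    ∏ k, v k ^ Finsupp.single j n k = v j ^ n := by
  classical
  rw [Finset.prod_eq_single j (fun k _ hk => by simp [hk.symm]) (by simp)]
  simp

/-- The coefficients in degree `N` of the multiples of the forms with coefficients `c` by the
monomials that are selected by `s`. -/
noncomputable def multiplesMatrix {R : Type*} [CommSemiring R] {N : ℕ}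
    (s : Exponent ι N → ι × (ι →₀ ℕ)) (c : ι × Exponent ι m → R) :
    Matrix (Exponent ι N) (Exponent ι N) R :=
  Matrix.of fun β α => coeff α.1 (monomial (s β).2 1 * formOf c (s β).1)

lemma map_multiplesMatrix {R S : Type*} [CommSemiring R] [CommSemiring S] {N : ℕ}
    (s : Exponent ι N → ι × (ι →₀ ℕ)) (f : R →+* S) (c : ι × Exponent ι m → R) :
    f.mapMatrix (multiplesMatrix s c) = multiplesMatrix s (f ∘ c) := by
  ext β α
  simp only [multiplesMatrix, RingHom.mapMatrix_apply, Matrix.map_apply, Matrix.of_apply]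
  rw [← coeff_map, map_mul, map_monomial, map_formOf, map_one]

lemma multiplesMatrix_mulVec {R : Type*} [CommSemiring R] {N : ℕ}
    (s : Exponent ι N → ι × (ι →₀ ℕ)) (c : ι × Exponent ι m → R) (v : ι → R)
    (hv : ∀ i, eval v (formOf c i) = 0) :
    (multiplesMatrix s c).mulVec (fun α => ∏ k, v k ^ α.1 k) = 0 := by
  ext β
  set p := monomial (s β).2 1 * formOf c (s β).1
  have hp : p.IsHomogeneous ((s β).2.degree + m) :=
    (isHomogeneous_monomial _ rfl).mul (formOf_isHomogeneous _ _)
  have hcoeff (α : Exponent ι N) : coeff α.1 p = coeff α.1 (homogeneousComponent N p) := by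
    rw [coeff_homogeneousComponent, if_pos ((Finsupp.degree_eq_sum _).trans α.2)]
  change ∑ α : Exponent ι N, coeff α.1 p * ∏ k, v k ^ α.1 k = 0
  simp only [hcoeff]
  rw [← (homogeneousComponent_isHomogeneous N p).eval_eq, homogeneousComponent_of_mem hp]
  split_ifs
  · simp [p, hv]
  · simp

lemma aeval_det_multiplesMatrix [DecidableEq ι] {R A : Type*} [CommRing R] [CommRing A]
    [Algebra R A] {N : ℕ} (s : Exponent ι N → ι × (ι →₀ ℕ)) (φ : ι × Exponent ι m → A) :
    aeval φ (multiplesMatrix s (X : _ → MvPolynomial (ι × Exponent ι m) R)).det =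
      (multiplesMatrix s φ).det := by
  rw [AlgHom.map_det]
  refine congrArg _ ((map_multiplesMatrix s (aeval (R := R) φ).toRingHom X).trans
    (congrArg _ ?_))
  ext
  simp

lemma isHomogeneous_multiplesMatrix {R : Type*} [CommSemiring R] {N : ℕ}
    (s : Exponent ι N → ι × (ι →₀ ℕ)) (β α : Exponent ι N) :
    (multiplesMatrix (m := m) (R := MvPolynomial (ι × Exponent ι m) R) s X β α).IsHomogeneous
      1 := by
  classical
  rw [multiplesMatrix, Matrix.of_apply, coeff_monomial_mul', formOf, coeff_sum]
  split_ifs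
  · rw [one_mul]
    refine IsHomogeneous.sum _ _ _ fun d _ => ?_
    rw [coeff_monomial]
    split_ifs
    · exact isHomogeneous_X _ _
    · exact isHomogeneous_zero _ _ _
  · exact isHomogeneous_zero _ _ _

lemma isHomogeneous_det {σ n R : Type*} [CommRing R] [Fintype n] [DecidableEq n]
    (M : Matrix n n (MvPolynomial σ R)) (hM : ∀ i j, (M i j).IsHomogeneous 1) :
    M.det.IsHomogeneous (Fintype.card n) := by
  rw [Matrix.det_apply]
  refine IsHomogeneous.sum _ _ _ fun σ _ => ?_
  have h : (∏ i, M (σ i) i).IsHomogeneous (Fintype.card n) := by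
    simpa using IsHomogeneous.prod Finset.univ (fun i => M (σ i) i) (fun _ => 1)
      fun i _ => hM _ _
  rcases Int.units_eq_one_or (Equiv.Perm.sign σ) with hσ | hσ
  · simpa [hσ] using h
  · simpa [hσ] using h.neg

/-- If all monomials of degree `N` lie in the ideal of the forms with coefficients `c`, then the
degree `N` multiples of these forms contain a basis of the space of forms of degree `N`. -/
lemma exists_linearIndependent_multiples {K : Type*} [Field K] (c : ι × Exponent ι m → K) (N : ℕ)
    (h : ∀ α : Exponent ι N, monomial α.1 1 ∈ Ideal.span (Set.range (formOf c))) :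
    ∃ s : Exponent ι N → ι × (ι →₀ ℕ), LinearIndependent K (multiplesMatrix s c).row := by
  classical
  let π : MvPolynomial ι K →ₗ[K] (Exponent ι N → K) := LinearMap.pi fun α => lcoeff K α.1
  let w : ι × (ι →₀ ℕ) → Exponent ι N → K := fun x => π (monomial x.2 1 * formOf c x.1)
  have hmul (g : MvPolynomial ι K) (i : ι) :
      π (g * formOf c i) ∈ Submodule.span K (Set.range w) := by
    induction g using MvPolynomial.induction_on' with
    | add p q hp hq => rw [add_mul, map_add]; exact add_mem hp hq
    | monomial d r =>
      have : monomial d r * formOf c i = r • (monomial d 1 * formOf c i) := by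
        rw [← smul_mul_assoc, smul_monomial, smul_eq_mul, mul_one]
      rw [this, map_smul]
      exact Submodule.smul_mem _ _ (Submodule.subset_span ⟨(i, d), rfl⟩)
  have htop : Submodule.span K (Set.range w) = ⊤ := by
    rw [eq_top_iff, ← (Pi.basisFun K (Exponent ι N)).span_eq, Submodule.span_le]
    rintro _ ⟨α, rfl⟩
    obtain ⟨g, hg⟩ := Ideal.mem_span_range_iff_exists_fun.1 (h α)
    have : Pi.basisFun K (Exponent ι N) α = π (monomial α.1 1) := by
      ext β
      simp [π, Pi.single_apply, coeff_monomial, Subtype.ext_iff, eq_comm]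
    rw [this, ← hg, map_sum]
    exact Submodule.sum_mem _ fun i _ => hmul _ _
  obtain ⟨κ, a, -, hspan, hli⟩ := exists_linearIndependent' K w
  let e := (Module.Basis.mk hli (by rw [hspan, htop])).indexEquiv (Pi.basisFun K (Exponent ι N))
  exact ⟨a ∘ e.symm, hli.comp _ e.symm.injective⟩

/-- If the forms with coefficients `c` have no common nontrivial zero, then all monomials of some
degree lie in the ideal that they generate. -/
lemma exists_forall_monomial_mem_span {K : Type*} [Field K] [IsAlgClosed K]
    (c : ι × Exponent ι m → K) (hc : ∀ v, (∀ i, eval v (formOf c i) = 0) → v = 0) :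
    ∃ N, ∀ α : Exponent ι N, monomial α.1 1 ∈ Ideal.span (Set.range (formOf c)) := by
  set I := Ideal.span (Set.range (formOf c))
  have hX (k : ι) : ∃ n, X k ^ n ∈ I := by
    rw [← Ideal.mem_radical_iff, ← vanishingIdeal_zeroLocus_eq_radical (K := K),
      mem_vanishingIdeal_iff]
    intro v hv
    have : v = 0 := hc v fun i => by
      simpa using hv _ (Ideal.subset_span ⟨i, rfl⟩)
    simp [this]
  choose n hn using hX
  refine ⟨∑ k, n k + 1, fun α => ?_⟩
  obtain ⟨k, hk⟩ : ∃ k, n k ≤ α.1 k := by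
    by_contra! hlt
    have := Finset.sum_le_sum fun k (_ : k ∈ Finset.univ) => (hlt k).le
    have := α.2
    omega
  refine I.mem_of_dvd (b := monomial α.1 1) ?_ (hn k)
  rw [X_pow_eq_monomial, monomial_dvd_monomial]
  exact ⟨Or.inr (by simpa [Finsupp.single_le_iff] using hk), dvd_rfl⟩

/-- If the forms with coefficients `c` have no common nontrivial zero, then some integer
polynomial that vanishes on all families with a nontrivial zero does not vanish at `c`. -/
lemma exists_eliminant.{u} {K : Type*} [Field K] [IsAlgClosed K]
    (c : ι × Exponent ι m → K) (hc : ∀ v, (∀ i, eval v (formOf c i) = 0) → v = 0) :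
    ∃ D : MvPolynomial (ι × Exponent ι m) ℤ, aeval c D ≠ 0 ∧ (∃ n, D.IsHomogeneous n) ∧
      ∀ (A : Type u) [CommRing A] [IsDomain A] (φ : ι × Exponent ι m → A) (ξ : ι → A), ξ ≠ 0 →
        (∀ i, eval ξ (formOf φ i) = 0) → aeval φ D = 0 := by
  classical
  obtain ⟨N, hN⟩ := exists_forall_monomial_mem_span c hc
  obtain ⟨s, hs⟩ := exists_linearIndependent_multiples c N hN
  refine ⟨(multiplesMatrix s X).det, ?_,
    ⟨_, isHomogeneous_det _ (isHomogeneous_multiplesMatrix s)⟩, fun A _ _ φ ξ hξ h0 => ?_⟩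
  · rw [aeval_det_multiplesMatrix]
    exact ((Matrix.isUnit_iff_isUnit_det _).1
      (Matrix.linearIndependent_rows_iff_isUnit.1 hs)).ne_zero
  · rw [aeval_det_multiplesMatrix]
    refine Matrix.exists_mulVec_eq_zero_iff.1 ⟨_, ?_, multiplesMatrix_mulVec s φ ξ h0⟩
    obtain ⟨j, hj⟩ := Function.ne_iff.1 hξ
    refine Function.ne_iff.2 ⟨⟨Finsupp.single j N, by simp [Finsupp.single_apply]⟩, ?_⟩
    rw [prod_pow_single]
    exact pow_ne_zero N hj

section Chart

variable [DecidableEq ι]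

/-- The exponent of the `m`-th power of the variable `j`. -/
noncomputable def powerExponent (m : ℕ) (j : ι) : Exponent ι m :=
  ⟨Finsupp.single j m, by simp [Finsupp.single_apply]⟩

/-- The generic point of the chart in which the coordinate `j` equals `1`. -/
noncomputable def chartPoint (m : ℕ) (j k : ι) : MvPolynomial ((ι × Exponent ι m) ⊕ ι) ℤ :=
  if k = j then 1 else X (Sum.inr k)

/-- The coefficients of the generic forms of degree `m` that vanish at `chartPoint m j`. -/
noncomputable def chartCoeff (j : ι) (s : ι × Exponent ι m) :
    MvPolynomial ((ι × Exponent ι m) ⊕ ι) ℤ :=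
  if s.2 = powerExponent m j then
    -∑ d ∈ Finset.univ.erase (powerExponent m j),
      X (Sum.inl (s.1, d)) * ∏ k, chartPoint m j k ^ d.1 k
  else X (Sum.inl s)

lemma eval_formOf_chartCoeff (j i : ι) :
    eval (chartPoint m j) (formOf (chartCoeff j) i) = 0 := by
  rw [eval_formOf, ← Finset.sum_erase_add _ _ (Finset.mem_univ (powerExponent m j))]
  have h : ∏ k, chartPoint m j k ^ (powerExponent m j).1 k = 1 := by
    rw [powerExponent, prod_pow_single, chartPoint, if_pos rfl, one_pow]
  rw [h, mul_one, chartCoeff, if_pos rfl, ← sub_eq_add_neg, sub_eq_zero]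
  exact Finset.sum_congr rfl fun d hd => by
    rw [chartCoeff, if_neg (Finset.ne_of_mem_erase hd)]

/-- The exponent of `X j ^ (m - 1) * X i`. -/
noncomputable def bumpExponent (hm : m ≠ 0) (j i : ι) : Exponent ι m :=
  ⟨Finsupp.single j (m - 1) + Finsupp.single i 1, by
    have h (k : ι) (n : ℕ) : ∑ l, Finsupp.single k n l = n := by simp [Finsupp.single_apply]
    simp only [Finsupp.add_apply, Finset.sum_add_distrib, h]
    omega⟩

lemma det_jacobian_chartCoeff_ne_zero (hm : m ≠ 0) (j : ι) :
    (Matrix.of fun i k : {k // k ≠ j} =>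
      pderiv (Sum.inr k.1) (chartCoeff j (i.1, powerExponent m j))).det ≠ 0 := by
  let ρ : MvPolynomial ((ι × Exponent ι m) ⊕ ι) ℤ →+* ℤ :=
    eval (Sum.elim (fun s => if s.2 = bumpExponent hm j s.1 then 1 else 0) fun _ => 0)
  suffices ρ.mapMatrix (Matrix.of fun i k : {k // k ≠ j} =>
      pderiv (Sum.inr k.1) (chartCoeff j (i.1, powerExponent m j))) = -1 by
    intro h
    have h2 := congrArg ρ h
    rw [RingHom.map_det, this, Matrix.det_neg, map_zero] at h2
    simp at h2
  ext i k
  have hne : bumpExponent hm j i.1 ≠ powerExponent m j := fun h => by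
    have := DFunLike.congr_fun (congrArg Subtype.val h) i.1
    simp [bumpExponent, powerExponent, i.2.symm] at this
  have hprod : ∏ l, chartPoint m j l ^ (bumpExponent hm j i.1).1 l = X (Sum.inr i.1) := by
    simp only [bumpExponent, Finsupp.add_apply, pow_add, Finset.prod_mul_distrib, prod_pow_single]
    simp [chartPoint, i.2]
  simp only [RingHom.mapMatrix_apply, Matrix.map_apply, Matrix.of_apply, chartCoeff, if_pos,
    map_neg, map_sum, Derivation.leibniz, smul_eq_mul, map_add, map_mul, Matrix.neg_apply]
  rw [Finset.sum_eq_single (bumpExponent hm j i.1)]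
  · rw [hprod]
    simp [ρ, pderiv_X, Pi.single_apply, Matrix.one_apply, Subtype.ext_iff, apply_ite]
  · intro d _ hd
    rw [pderiv_X_of_ne (by simp)]
    simp [ρ, hd]
  · intro h
    simp [hne] at h

/-- The polynomials that vanish on the families of forms with a common zero in the chart `j`
form a principal ideal. -/
lemma exists_ker_chartCoeff_eq_span (hm : m ≠ 0) (j : ι) :
    ∃ f, RingHom.ker (aeval (R := ℤ) (chartCoeff (m := m) j)) = Ideal.span {f} := by
  have : (RingHom.ker (aeval (R := ℤ) (chartCoeff (m := m) j))).IsPrime := RingHom.ker_isPrime _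
  refine isPrincipal_of_pderiv (j, powerExponent m j) _ fun p hp hp₀ => ?_
  refine eq_zero_of_aeval_eq_zero_of_jacobian (chartCoeff j) (j, powerExponent m j)
    (fun i : {k // k ≠ j} => (i.1, powerExponent m j))
    (fun i k h => Subtype.ext (Prod.ext_iff.1 h).1)
    Subtype.val (fun s hs₀ hs => ?_) (det_jacobian_chartCoeff_ne_zero hm j) p hp₀ hp
  rw [chartCoeff, if_neg]
  intro h
  by_cases hj : s.1 = j
  · exact hs₀ (Prod.ext hj h)
  · exact hs ⟨s.1, hj⟩ (Prod.ext rfl h)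

/-- There is a homogeneous integer polynomial that vanishes on all families of forms with a common
zero in the chart `j`, and only on families with a common nontrivial zero. -/
lemma exists_chart_resultant.{u} (hm : m ≠ 0) (j : ι) :
    ∃ f : MvPolynomial (ι × Exponent ι m) ℤ, (∃ n, f.IsHomogeneous n) ∧
      ∀ (K : Type u) [Field K] [IsAlgClosed K] (c : ι × Exponent ι m → K),
        (aeval c f = 0 → ∃ v ≠ 0, ∀ i, eval v (formOf c i) = 0) ∧
        ∀ v : ι → K, v j = 1 → (∀ i, eval v (formOf c i) = 0) → aeval c f = 0 := by
  obtain ⟨f, hf⟩ := exists_ker_chartCoeff_eq_span hm j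
  have hpt : chartPoint m j ≠ 0 := fun h => by
    simpa [chartPoint] using congrFun h j
  have hdvd {D : MvPolynomial (ι × Exponent ι m) ℤ} (hD : aeval (chartCoeff j) D = 0) : f ∣ D := by
    rwa [← Ideal.mem_span_singleton, ← hf, RingHom.mem_ker]
  refine ⟨f, ?_, fun K _ _ c => ⟨fun h => ?_, fun v hvj hv => ?_⟩⟩
  · let c : ι × Exponent ι m → AlgebraicClosure ℚ :=
      fun s => if s.2 = powerExponent m s.1 then 1 else 0
    obtain ⟨D, hD, ⟨n, hn⟩, hD'⟩ := exists_eliminant c fun v hv => by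
      ext i
      have := hv i
      simp only [eval_formOf, c, ite_mul, one_mul, zero_mul, Finset.sum_ite_eq', Finset.mem_univ,
        if_true] at this
      rw [powerExponent, prod_pow_single] at this
      exact eq_zero_of_pow_eq_zero this
    exact hn.of_dvd (fun h => hD (by rw [h, map_zero]))
      (hdvd (hD' _ (chartCoeff j) _ hpt (eval_formOf_chartCoeff j)))
  · by_contra! hc
    obtain ⟨D, hD, -, hD'⟩ := exists_eliminant c fun v hv => by
      by_contra h0
      obtain ⟨i, hi⟩ := hc v h0
      exact hi (hv i)
    have := map_dvd (aeval c) (hdvd (hD' _ (chartCoeff j) _ hpt (eval_formOf_chartCoeff j)))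
    rw [h, zero_dvd_iff] at this
    exact hD this
  · let ρ : MvPolynomial ((ι × Exponent ι m) ⊕ ι) ℤ →ₐ[ℤ] K := aeval (Sum.elim c v)
    have hρ (k : ι) : ρ (chartPoint m j k) = v k := by
      by_cases hk : k = j
      · rw [chartPoint, if_pos hk, map_one, hk, hvj]
      · rw [chartPoint, if_neg hk]
        simp [ρ]
    have hcomp : ρ.comp (aeval (chartCoeff j)) = aeval c := by
      ext ⟨i, d⟩
      simp only [AlgHom.comp_apply, aeval_X]
      by_cases hd : d = powerExponent m j
      · have h := hv i
        rw [eval_formOf, ← Finset.sum_erase_add _ _ (Finset.mem_univ (powerExponent m j))] at h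
        simp only [chartCoeff, if_pos hd, map_neg, map_sum, map_mul, map_prod, map_pow, hρ]
        rw [neg_eq_iff_add_eq_zero, ← h, hd]
        congr 1
        · simp [ρ]
        · rw [powerExponent, prod_pow_single, hvj, one_pow, mul_one]
      · rw [chartCoeff, if_neg hd]
        simp [ρ]
    have hf0 : aeval (chartCoeff j) f = 0 := by
      rw [← RingHom.mem_ker, hf]
      exact Ideal.mem_span_singleton_self f
    rw [← hcomp, AlgHom.comp_apply, hf0, map_zero]

/-- There is a homogeneous integer polynomial in the coefficients of as many forms of degree `m` as
there are variables that vanishes exactly when the forms have a common nontrivial zero. -/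
theorem exists_resultant.{u} (hm : m ≠ 0) :
    ∃ f : MvPolynomial (ι × Exponent ι m) ℤ, (∃ n, f.IsHomogeneous n) ∧
      ∀ (K : Type u) [Field K] [IsAlgClosed K] (c : ι × Exponent ι m → K),
        aeval c f = 0 ↔ ∃ v ≠ 0, ∀ i, eval v (formOf c i) = 0 := by
  choose f hhom hf using fun j : ι => exists_chart_resultant.{_, u} hm j
  choose n hn using hhom
  refine ⟨∏ j, f j, ⟨_, IsHomogeneous.prod _ _ n fun j _ => hn j⟩, fun K _ _ c => ?_⟩
  rw [map_prod, Finset.prod_eq_zero_iff]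
  constructor
  · rintro ⟨j, -, hj⟩
    exact (hf j K c).1 hj
  · rintro ⟨v, hv0, hv⟩
    obtain ⟨j, hj⟩ := Function.ne_iff.1 hv0
    refine ⟨j, Finset.mem_univ j, (hf j K c).2 (fun k => (v j)⁻¹ * v k) (inv_mul_cancel₀ hj)
      fun i => ?_⟩
    have h := hv i
    rw [eval_formOf] at h ⊢
    simp only [mul_pow, Finset.prod_mul_distrib, Finset.prod_pow_eq_pow_sum]
    rw [Finset.sum_congr rfl fun d _ => by rw [d.2, mul_left_comm], ← Finset.mul_sum, h, mul_zero]

end Chart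

/-- The exponent obtained by raising the exponent of the variable `i` by one. -/
noncomputable def Exponent.succ [DecidableEq ι] (i : ι) (d : Exponent ι m) : Exponent ι (m + 1) :=
  ⟨d.1 + Finsupp.single i 1, by simp [Finset.sum_add_distrib, d.2, Finsupp.single_apply]⟩

lemma IsHomogeneous.pderiv_eq_formOf [DecidableEq ι] {R : Type*} [CommRing R] {F : MvPolynomial ι R}
    (hF : F.IsHomogeneous (m + 1)) (i : ι) :
    pderiv i F = formOf (fun s : ι × Exponent ι m =>
      coeff (s.2.succ s.1).1 F * (s.2.1 s.1 + 1)) i := by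
  have h : (pderiv i F).IsHomogeneous m := hF.pderiv
  rw [h.eq_sum_monomial, formOf]
  simp only [coeff_pderiv]
  rfl

/-- There is a nonzero homogeneous integer polynomial that vanishes at the coefficients of a form
of degree `m + 1` exactly when the form is not smooth. -/
theorem exists_discriminant_of_degree [DecidableEq ι] (hm : m ≠ 0) :
    ∃ Δ : MvPolynomial (Exponent ι (m + 1)) ℤ, Δ ≠ 0 ∧ (∃ n, Δ.IsHomogeneous n) ∧
      ∀ (K : Type) [Field K] [IsAlgClosed K] (F : MvPolynomial ι K), F.IsHomogeneous (m + 1) →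
        (aeval (fun d : Exponent ι (m + 1) => coeff d.1 F) Δ = 0 ↔
          ∃ v ≠ 0, ∀ i, eval v (pderiv i F) = 0) := by
  obtain ⟨f, ⟨n, hn⟩, hf⟩ := exists_resultant.{_, 0} (ι := ι) hm
  let g : ι × Exponent ι m → MvPolynomial (Exponent ι (m + 1)) ℤ :=
    fun s => C (s.2.1 s.1 + 1 : ℤ) * X (s.2.succ s.1)
  have key (K : Type) [Field K] [IsAlgClosed K] (F : MvPolynomial ι K)
      (hF : F.IsHomogeneous (m + 1)) :
      aeval (fun d : Exponent ι (m + 1) => coeff d.1 F) (aeval g f) = 0 ↔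
        ∃ v ≠ 0, ∀ i, eval v (pderiv i F) = 0 := by
    simp only [hF.pderiv_eq_formOf, ← hf]
    rw [← AlgHom.comp_apply, comp_aeval]
    simp [g, mul_comm]
  refine ⟨aeval g f, fun h => ?_, ⟨_, hn.aeval g fun s => isHomogeneous_C_mul_X _ _⟩, key⟩
  obtain ⟨v, hv0, hv⟩ := (key (AlgebraicClosure ℚ) (∑ i, X i ^ (m + 1))
    (IsHomogeneous.sum _ _ _ fun i _ => isHomogeneous_X_pow i _)).1 (by rw [h, map_zero])
  apply hv0
  ext1 i
  have := hv i
  rw [map_sum, Finset.sum_eq_single i (fun k _ hk => by simp [pderiv_X_of_ne hk])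
    (by simp)] at this
  simp only [pderiv_pow, pderiv_X_self] at this
  have hm1 : (m : AlgebraicClosure ℚ) + 1 ≠ 0 := Nat.cast_add_one_ne_zero m
  simpa [hm1, hm] using this

end Forms

end MvPolynomial

/-- There is a nonzero homogeneous integer polynomial `Δ` in 20 variables (indexed by the
degree-3 monomials in 4 variables) and a finite set `S` of primes such that for every
algebraically closed field `K` of characteristic zero or outside `S`, and every homogeneous
cubic form `F` over `K`, `Δ` vanishes on the coefficients of `F` iff `F` is not smooth. -/
theorem exists_discriminant :
    ∃ (Δ : MvPolynomial {d : Fin 4 →₀ ℕ // ∑ i : Fin 4, d i = 3} ℤ) (S : Finset ℕ),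
      Δ ≠ 0 ∧ (∃ n : ℕ, Δ.IsHomogeneous n) ∧ (∀ p ∈ S, p.Prime) ∧
      ∀ (K : Type) (_ : Field K) (_ : IsAlgClosed K), ringChar K ∉ S →
        ∀ F : MvPolynomial (Fin 4) K, F.IsHomogeneous 3 →
          (aeval (fun d : {d : Fin 4 →₀ ℕ // ∑ i : Fin 4, d i = 3} => coeff d.1 F) Δ = 0 ↔
            ¬ (∀ v : Fin 4 → K, v ≠ 0 → ∃ i : Fin 4, eval v (pderiv i F) ≠ 0)) := by
  obtain ⟨Δ, hΔ, hhom, h⟩ := exists_discriminant_of_degree (ι := Fin 4) (two_ne_zero : (2 : ℕ) ≠ 0)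
  refine ⟨Δ, ∅, hΔ, hhom, by simp, fun K _ _ _ F hF => (h K F hF).trans ?_⟩
  push Not
  rfl
end
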